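/- arXiv:2306.07943 — 4 statements merged into one kernel-verified Lean document; each statement's English description precedes it below -/
import Mathlib

section
/- Let n, m be natural numbers with n ≤ m, let |·|_a be a norm on ℝ^n whose unit sphere contains a point that is not an extremal point of the unit ball B_a, and let |·|_b be an arbitrary norm on ℝ^m. Let X = ([-1,1]^n, |·|_a) be the cube equipped with the metric induced by |·|_a. Then for every Δ ≥ 0, the set {f ∈ Lip_1(X, (ℝ^m, |·|_b)) : H^n(f(X)) > Δ} is residual in Lip_1(X, (ℝ^m, |·|_b)) if and only if Δ = 0. -/
open MeasureTheory Metric Set Filter Topology ENNReal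

noncomputable section

abbrev Euc (n : ℕ) : Type := EuclideanSpace ℝ (Fin n)

/-- The cube `[-1,1]^n` in `ℝ^n`. -/
def cube (n : ℕ) : Set (Euc n) := {x | ∀ i, |x i| ≤ 1}

/-- `u` is an extremal point of the convex set `K`: `u + v ∈ K` and `u - v ∈ K` imply `v = 0`. -/
def IsExtremalPt {V : Type*} [AddCommGroup V] (K : Set V) (u : V) : Prop :=
  ∀ v, u + v ∈ K → u - v ∈ K → v = 0

/-- The space of bounded functions on `D ⊆ ℝ^n` which are `1`-Lipschitz from `(D, |·|_a)` to
`(ℝ^m, |·|_b)`, with the supremum metric. -/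
abbrev LipAB {n m : ℕ} (na : Seminorm ℝ (Euc n)) (nb : Seminorm ℝ (Euc m)) (D : Set (Euc n)) :=
  {f : BoundedContinuousFunction (↥D) (Euc m) //
    ∀ x y : ↥D, nb (f x - f y) ≤ na ((x : Euc n) - (y : Euc n))}

/-- For every linear `M`, the determinant of `1 + M` is a fixed linear combination of the
determinants of `1 + t j • M`, by Lagrange interpolation at the nodes `t j`. -/
lemma exists_det_one_add_eq_sum (n : ℕ) (t : ℕ → ℝ) (ht : Function.Injective t) :
    ∃ c : ℕ → ℝ, ∀ M : Euc n →L[ℝ] Euc n,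
      (1 + M).det = ∑ j ∈ Finset.range (n + 1), c j * (1 + t j • M).det := by
  refine ⟨fun j => (Lagrange.basis (Finset.range (n + 1)) t j).eval 1, fun M => ?_⟩
  set b := (EuclideanSpace.basisFun (Fin n) ℝ).toBasis
  set A := LinearMap.toMatrix b b (M : Euc n →ₗ[ℝ] Euc n) with hA
  set p : Polynomial ℝ :=
    ((Polynomial.X : Polynomial ℝ) • A.map Polynomial.C
      + (1 : Matrix (Fin n) (Fin n) ℝ).map Polynomial.C).det with hp
  have hev : ∀ s : ℝ, p.eval s = (1 + s • M).det := by
    intro s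
    have h1 : p.eval s = (s • A + 1).det := by
      rw [hp, ← Polynomial.coe_evalRingHom, RingHom.map_det]
      congr 1
      ext i j
      simp only [Polynomial.coe_evalRingHom, RingHom.mapMatrix_apply, Matrix.map_apply,
        Matrix.add_apply, Matrix.smul_apply, smul_eq_mul, Polynomial.eval_add, Polynomial.eval_mul,
        Polynomial.eval_X, Polynomial.eval_C]
    rw [h1, ContinuousLinearMap.det, ← LinearMap.det_toMatrix b]
    congr 1
    have : ((1 + s • M : Euc n →L[ℝ] Euc n) : Euc n →ₗ[ℝ] Euc n)
        = s • (M : Euc n →ₗ[ℝ] Euc n) + LinearMap.id := by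
      ext x; simp [add_comm]
    rw [this, map_add, map_smul, LinearMap.toMatrix_id]
  have hdeg : p.degree < ((Finset.range (n + 1)).card : ℕ) := by
    refine lt_of_le_of_lt Polynomial.degree_le_natDegree ?_
    have := Polynomial.natDegree_det_X_add_C_le A 1
    rw [Fintype.card_fin] at this
    rw [Finset.card_range]
    exact_mod_cast Nat.lt_succ_of_le this
  have hI := Lagrange.eq_interpolate_of_eval_eq (fun j => (1 + t j • M).det) (ht.injOn)
    hdeg (fun i _ => hev (t i))
  have h1 := hev 1
  rw [one_smul] at h1
  rw [← h1, hI, Lagrange.interpolate_apply, Polynomial.eval_finsetSum]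
  simp [mul_comm]

/-- The determinant is bounded on bounded sets of linear maps. -/
lemma exists_abs_det_le (n : ℕ) (K : ℝ) :
    ∃ C : ℝ, ∀ M : Euc n →L[ℝ] Euc n, ‖M‖ ≤ K → |(1 + M).det| ≤ C := by
  have hc : Continuous fun M : Euc n →L[ℝ] Euc n => (1 + M).det :=
    ContinuousLinearMap.continuous_det.comp (by fun_prop)
  obtain ⟨C, hC⟩ := (isCompact_closedBall (0 : Euc n →L[ℝ] Euc n) K).exists_bound_of_continuousOn
    hc.continuousOn
  exact ⟨C, fun M hM => hC M (by simpa using hM)⟩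

lemma integrableOn_det_one_add_fderiv {n : ℕ} {u : Euc n → Euc n} {K : NNReal}
    (hu : LipschitzWith K u) {B : Set (Euc n)} (hB : μH[n] B ≠ ∞) (t : ℝ) :
    IntegrableOn (fun x => (1 + t • fderiv ℝ u x).det) B μH[n] := by
  obtain ⟨C, hC⟩ := exists_abs_det_le n (|t| * K)
  have hm : Measurable fun x => (1 + t • fderiv ℝ u x).det := by
    have : Continuous fun M : Euc n →L[ℝ] Euc n => (1 + t • M).det :=
      ContinuousLinearMap.continuous_det.comp (by fun_prop)
    exact this.measurable.comp (measurable_fderiv ℝ u)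
  refine Measure.integrableOn_of_bounded (M := C) hB hm.aestronglyMeasurable
    (Eventually.of_forall fun x => ?_)
  refine hC _ ?_
  rw [norm_smul, Real.norm_eq_abs]
  gcongr
  exact norm_fderiv_le_of_lipschitz ℝ hu

lemma ae_fderiv_of_lipschitz {n : ℕ} {F : Type*} [NormedAddCommGroup F] [NormedSpace ℝ F]
    [FiniteDimensional ℝ F] {u : Euc n → F} {K : NNReal} (hu : LipschitzWith K u) :
    μH[n] {x | DifferentiableAt ℝ u x}ᶜ = 0 :=
  hu.ae_differentiableAt (μ := (μH[n] : Measure (Euc n)))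

/-- A small Lipschitz perturbation of the identity supported in `B` maps `B` bijectively to
itself, so the integral of its Jacobian is the measure of `B`. -/
lemma integral_det_one_add_smul_fderiv {n : ℕ} {u : Euc n → Euc n} {K : NNReal}
    (hu : LipschitzWith K u) {B : Set (Euc n)} (hB : MeasurableSet B)
    (h0 : ∀ x, x ∉ B → u x = 0) {t : ℝ} (ht : |t| * K < 1)
    (hdet : ∀ M : Euc n →L[ℝ] Euc n, ‖M‖ ≤ |t| * K → 0 ≤ (1 + M).det) :
    ∫ x in B, (1 + t • fderiv ℝ u x).det ∂μH[n] = (μH[n] : Measure (Euc n)).real B := by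
  set g : Euc n → Euc n := fun x => x + t • u x with hg
  have hLt : LipschitzWith (‖t‖₊ * K) (fun x => t • u x) := by
    refine LipschitzWith.of_dist_le_mul fun x y => ?_
    rw [dist_eq_norm, ← smul_sub, norm_smul, NNReal.coe_mul, coe_nnnorm,
      mul_assoc, ← dist_eq_norm]
    gcongr
    exact hu.dist_le_mul x y
  have hgL : LipschitzWith (1 + ‖t‖₊ * K) g := LipschitzWith.id.add hLt
  have hinj : Function.Injective g := by
    intro x y hxy
    by_contra hne
    have h1 : x - y = t • u y - t • u x := by
      have : x + t • u x = y + t • u y := hxy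
      rw [sub_eq_sub_iff_add_eq_add, this, add_comm]
    have h2 := hLt.dist_le_mul y x
    rw [dist_eq_norm, ← h1, ← dist_eq_norm, dist_comm y x] at h2
    have h3 : 0 < dist x y := dist_pos.2 hne
    rw [NNReal.coe_mul, coe_nnnorm, Real.norm_eq_abs] at h2
    nlinarith
  have hsurj : Function.Surjective g := by
    intro y
    have hc : ContractingWith (‖t‖₊ * K) (fun x => y - t • u x) := by
      refine ⟨by rw [← Real.norm_eq_abs, ← coe_nnnorm] at ht; exact_mod_cast ht, LipschitzWith.of_dist_le_mul fun a b => ?_⟩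
      rw [dist_sub_left]
      exact hLt.dist_le_mul a b
    refine ⟨ContractingWith.fixedPoint _ hc, ?_⟩
    have := ContractingWith.fixedPoint_isFixedPt hc
    have h2 : y - t • u (ContractingWith.fixedPoint _ hc) = ContractingWith.fixedPoint _ hc := this
    simp only [hg]
    nth_rw 1 [← h2]
    simp
  have hgB : g '' B = B := by
    have hid : ∀ x, x ∉ B → g x = x := fun x hx => by simp [hg, h0 x hx]
    apply Subset.antisymm
    · rintro _ ⟨x, hx, rfl⟩
      by_contra hgx
      exact hgx ((hinj (hid _ hgx)).symm ▸ hx)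
    · intro y hy
      obtain ⟨x, rfl⟩ := hsurj y
      refine ⟨x, ?_, rfl⟩
      by_contra hx
      exact hx (hid x hx ▸ hy)
  set D := {x | DifferentiableAt ℝ u x} with hD
  have hDm : MeasurableSet D := measurableSet_of_differentiableAt ℝ u
  have hDn : μH[n] Dᶜ = 0 := ae_fderiv_of_lipschitz hu
  have hder : ∀ x ∈ B ∩ D, HasFDerivWithinAt g (1 + t • fderiv ℝ u x) (B ∩ D) x := by
    intro x hx
    have : HasFDerivAt g (ContinuousLinearMap.id ℝ (Euc n) + t • fderiv ℝ u x) x :=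
      (hasFDerivAt_id x).add (hx.2.hasFDerivAt.const_smul t)
    exact this.hasFDerivWithinAt
  have hcov := integral_image_eq_integral_abs_det_fderiv_smul (μH[n] : Measure (Euc n))
    (hB.inter hDm) hder hinj.injOn (fun _ => (1 : ℝ))
  have himg : (μH[n] : Measure (Euc n)) (g '' (B ∩ D)) = μH[n] B := by
    apply le_antisymm
    · exact measure_mono ((image_mono inter_subset_left).trans hgB.le)
    · have hnull : (μH[n] : Measure (Euc n)) (g '' Dᶜ) = 0 := by
        refine le_antisymm ((hgL.hausdorffMeasure_image_le n.cast_nonneg _).trans ?_) bot_le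
        rw [hDn, mul_zero]
      calc (μH[n] : Measure (Euc n)) B ≤ μH[n] (g '' (B ∩ D) ∪ g '' Dᶜ) := by
            refine measure_mono ?_
            rw [← image_union]
            nth_rw 1 [← hgB]
            refine image_mono fun x hx => ?_
            by_cases h : x ∈ D
            · exact Or.inl ⟨hx, h⟩
            · exact Or.inr h
        _ ≤ _ := (measure_union_le _ _).trans (by rw [hnull, add_zero])
  have hae : (B ∩ D : Set (Euc n)) =ᵐ[μH[n]] B := by
    have : D =ᵐ[μH[n]] (univ : Set (Euc n)) := ae_eq_univ.2 hDn
    simpa using (ae_eq_refl B).inter this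
  rw [setIntegral_const, smul_eq_mul, mul_one, measureReal_def, himg, setIntegral_congr_set hae]
    at hcov
  rw [measureReal_def, hcov]
  refine integral_congr_ae (Eventually.of_forall fun x => ?_)
  simp only [smul_eq_mul, mul_one]
  refine (abs_of_nonneg (hdet _ ?_)).symm
  rw [norm_smul, Real.norm_eq_abs]
  gcongr
  exact norm_fderiv_le_of_lipschitz ℝ hu

/-- The Jacobian of a Lipschitz map which agrees with the identity off `B` has integral over `B`
equal to the measure of `B`. -/
lemma integral_det_one_add_fderiv {n : ℕ} {u : Euc n → Euc n} {K : NNReal}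
    (hu : LipschitzWith K u) {B : Set (Euc n)} (hB : MeasurableSet B) (hBfin : μH[n] B ≠ ∞)
    (h0 : ∀ x, x ∉ B → u x = 0) :
    ∫ x in B, (1 + fderiv ℝ u x).det ∂μH[n] = (μH[n] : Measure (Euc n)).real B := by
  have hc : Continuous fun M : Euc n →L[ℝ] Euc n => (1 + M).det :=
    ContinuousLinearMap.continuous_det.comp (by fun_prop)
  have hpos : ∀ᶠ M in 𝓝 (0 : Euc n →L[ℝ] Euc n), 0 < (1 + M).det := by
    refine hc.continuousAt.eventually_const_lt ?_
    have : (1 + 0 : Euc n →L[ℝ] Euc n).det = 1 := by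
      rw [add_zero]; exact LinearMap.det_id
    simp only [this, one_pos]
  obtain ⟨ρ, hρ, hρ'⟩ := Metric.eventually_nhds_iff.1 hpos
  set s : ℝ := min ρ 1 / (2 * (K + 1)) with hs
  have hK : (0 : ℝ) ≤ K := K.2
  have hs0 : 0 < s := by positivity
  have hsK : s * K < min ρ 1 := by
    rw [hs, div_mul_eq_mul_div, div_lt_iff₀ (by positivity)]
    have : 0 < min ρ 1 := by positivity
    nlinarith
  set t : ℕ → ℝ := fun j => s / (j + 1) with ht
  have htinj : Function.Injective t := by
    intro i j hij
    simp only [ht] at hij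
    rw [div_eq_div_iff (by positivity) (by positivity)] at hij
    have := mul_left_cancel₀ hs0.ne' hij
    exact_mod_cast (add_right_cancel this).symm
  have htK : ∀ j, |t j| * K < min ρ 1 := by
    intro j
    have h1 : t j ≤ s := div_le_self hs0.le (by linarith [j.cast_nonneg (α := ℝ)])
    have h2 : 0 ≤ t j := by positivity
    rw [abs_of_nonneg h2]
    exact (mul_le_mul_of_nonneg_right h1 hK).trans_lt hsK
  have h_int : ∀ j, ∫ x in B, (1 + t j • fderiv ℝ u x).det ∂μH[n]
      = (μH[n] : Measure (Euc n)).real B := fun j =>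
    integral_det_one_add_smul_fderiv hu hB h0 ((htK j).trans_le (min_le_right _ _))
      fun M hM => (hρ' (by
        rw [dist_zero_right]
        exact hM.trans_lt ((htK j).trans_le (min_le_left _ _)))).le
  obtain ⟨c, hcM⟩ := exists_det_one_add_eq_sum n t htinj
  have hsum : ∑ j ∈ Finset.range (n + 1), c j = 1 := by
    have h1 : ((1 : Euc n →L[ℝ] Euc n) + 0).det = 1 := by
      rw [add_zero]; exact LinearMap.det_id
    have h2 : ∀ j, ((1 : Euc n →L[ℝ] Euc n) + t j • (0 : Euc n →L[ℝ] Euc n)).det = 1 := fun j =>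
      (congrArg ContinuousLinearMap.det (by ext; simp)).trans h1
    simpa only [h1, h2, mul_one] using (hcM 0).symm
  calc ∫ x in B, (1 + fderiv ℝ u x).det ∂μH[n]
      = ∫ x in B, ∑ j ∈ Finset.range (n + 1), c j * (1 + t j • fderiv ℝ u x).det ∂μH[n] := by
        simp_rw [← hcM]
    _ = ∑ j ∈ Finset.range (n + 1), c j * (μH[n] : Measure (Euc n)).real B := by
        rw [integral_finsetSum _ fun j _ =>
          (integrableOn_det_one_add_fderiv hu hBfin (t j)).const_mul (c j)]
        simp_rw [integral_const_mul, h_int]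
    _ = _ := by rw [← Finset.sum_mul, hsum, one_mul]

/-- If a map differentiable on `s` has null image, its Jacobian vanishes almost everywhere. -/
lemma measure_det_ne_zero_of_image_null {n : ℕ} {g : Euc n → Euc n}
    {g' : Euc n → Euc n →L[ℝ] Euc n}
    {s : Set (Euc n)} (hs : MeasurableSet s) (hg : ∀ x ∈ s, HasFDerivWithinAt g (g' x) s x)
    (h0 : μH[n] (g '' s) = 0) (hdet : ∀ x ∈ s, (g' x).det ≠ 0) :
    (μH[n] : Measure (Euc n)) s = 0 := by
  rcases s.eq_empty_or_nonempty with rfl | hne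
  · simp
  have hr : ∀ A : Euc n →L[ℝ] Euc n, ∃ r : NNReal, r ≠ 0 ∧
      (A.det ≠ 0 → ∀ t : Set (Euc n), ApproximatesLinearOn g A t r → InjOn g t) := by
    intro A
    by_cases hA : A.det = 0
    · exact ⟨1, one_ne_zero, fun h => absurd hA h⟩
    set A' : Euc n ≃L[ℝ] Euc n := A.toContinuousLinearEquivOfDetNeZero hA
    have hA' : (A' : Euc n →L[ℝ] Euc n) = A := by ext; rfl
    rcases subsingleton_or_nontrivial (Euc n) with hsub | hnt
    · exact ⟨1, one_ne_zero, fun _ t _ => Function.Injective.injOn (fun x y _ =>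
        Subsingleton.elim x y)⟩
    · have hpos : 0 < ‖(A'.symm : Euc n →L[ℝ] Euc n)‖₊⁻¹ :=
        inv_pos.2 (A'.nnnorm_symm_pos)
      refine ⟨‖(A'.symm : Euc n →L[ℝ] Euc n)‖₊⁻¹ / 2, (half_pos hpos).ne', fun _ t ht => ?_⟩
      rw [← hA'] at ht
      exact ht.injOn (Or.inr (NNReal.half_lt_self hpos.ne'))
  choose r hr0 hrinj using hr
  obtain ⟨t, A, -, htm, hst, hta, hAy⟩ :=
    exists_partition_approximatesLinearOn_of_hasFDerivWithinAt g s g' hg r hr0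
  refine measure_mono_null (fun x hx => ?_) (measure_iUnion_null (s := fun k => s ∩ t k) fun k => ?_)
  · obtain ⟨k, hk⟩ := mem_iUnion.1 (hst hx)
    exact mem_iUnion.2 ⟨k, hx, hk⟩
  obtain ⟨y, hy, hAk⟩ := hAy hne k
  have hinj : InjOn g (s ∩ t k) := hrinj (A k) (hAk ▸ hdet y hy) _ (hta k)
  have hder : ∀ x ∈ s ∩ t k, HasFDerivWithinAt g (g' x) (s ∩ t k) x :=
    fun x hx => (hg x hx.1).mono inter_subset_left
  have hm := hs.inter (htm k)
  have hcov := lintegral_abs_det_fderiv_eq_addHaar_image (μH[n] : Measure (Euc n)) hm hder hinj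
  rw [measure_mono_null (image_mono inter_subset_left) h0] at hcov
  have hae := (lintegral_eq_zero_iff' (ENNReal.measurable_ofReal.comp_aemeasurable
    ((ContinuousLinearMap.continuous_det.measurable.comp_aemeasurable
      (aemeasurable_fderivWithin _ hm hder)).abs))).1 hcov
  rw [Filter.EventuallyEq, ae_restrict_iff' hm] at hae
  refine measure_mono_null ?_ hae
  intro x hx h
  have h2 := h hx
  simp only [Pi.zero_apply, Function.comp_apply, ENNReal.ofReal_eq_zero] at h2
  exact hdet x hx.1 (abs_eq_zero.1 (le_antisymm h2 (abs_nonneg _)))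

lemma exists_measure_annulus_lt (n : ℕ) (C : ℝ) :
    ∃ τ : ℝ, 0 < τ ∧ τ < 1 ∧
      C * (μH[n] : Measure (Euc n)).real (closedBall 0 1 \ ball 0 (1 - τ))
        < (μH[n] : Measure (Euc n)).real (closedBall 0 1) := by
  set μ : Measure (Euc n) := μH[n] with hμ
  have hpos : 0 < μ.real (closedBall 0 1) :=
    ENNReal.toReal_pos (measure_closedBall_pos μ _ one_pos).ne' measure_closedBall_lt_top.ne
  have hlim : Tendsto (fun τ : ℝ => C * (1 - (1 - τ) ^ n)) (𝓝[>] 0) (𝓝 0) := by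
    have : Continuous fun τ : ℝ => C * (1 - (1 - τ) ^ n) := by fun_prop
    simpa using (this.tendsto 0).mono_left nhdsWithin_le_nhds
  obtain ⟨τ, hτ1, hτ0, hτ⟩ := ((hlim.eventually (gt_mem_nhds one_pos)).and
    (Ioo_mem_nhdsGT (one_pos : (0 : ℝ) < 1))).exists
  refine ⟨τ, hτ0, hτ, ?_⟩
  have hb : μ.real (ball 0 (1 - τ)) = (1 - τ) ^ n * μ.real (closedBall 0 1) := by
    rw [measureReal_def, measureReal_def, Measure.addHaar_ball_of_pos μ _ (by linarith),
      Measure.addHaar_closedBall μ 0 zero_le_one, ENNReal.toReal_mul, ENNReal.toReal_ofReal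
      (pow_nonneg (by linarith) _)]
    simp
  rw [measureReal_sdiff (ball_subset_closedBall.trans (closedBall_subset_closedBall (by linarith)))
    measurableSet_ball measure_closedBall_lt_top.ne, hb]
  nlinarith

lemma lipschitzWith_cutoff {E : Type*} [NormedAddCommGroup E] [NormedSpace ℝ E]
    {τ : ℝ} (hτ : 0 < τ) {w : E → E} {L : NNReal}
    (hw : LipschitzWith L w) (hwb : ∀ x ∈ closedBall (0 : E) 1, ‖w x‖ ≤ τ) :
    LipschitzWith (1 + L) (fun x => (max 0 (min 1 ((1 - ‖x‖) / τ))) • w x) := by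
  set χ : E → ℝ := fun x => max 0 (min 1 ((1 - ‖x‖) / τ)) with hχ
  have hχ0 : ∀ x, 0 ≤ χ x := fun x => le_max_left _ _
  have hχ1 : ∀ x, χ x ≤ 1 := fun x => max_le zero_le_one (min_le_left _ _)
  have hχL : ∀ x y, |χ x - χ y| * τ ≤ ‖x - y‖ := by
    intro x y
    have h0 : LipschitzWith 1 fun r : ℝ => max 0 (min 1 r) :=
      (LipschitzWith.id.const_min 1).const_max 0
    have h1 : |χ x - χ y| ≤ |(1 - ‖x‖) / τ - (1 - ‖y‖) / τ| := by
      simpa [Real.dist_eq] using h0.dist_le_mul ((1 - ‖x‖) / τ) ((1 - ‖y‖) / τ)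
    rw [← sub_div, abs_div, abs_of_pos hτ, le_div_iff₀ hτ] at h1
    refine h1.trans ?_
    rw [show 1 - ‖x‖ - (1 - ‖y‖) = ‖y‖ - ‖x‖ by ring, norm_sub_rev]
    exact abs_norm_sub_norm_le _ _
  have hχout : ∀ x, x ∉ closedBall (0 : E) 1 → χ x = 0 := by
    intro x hx
    rw [mem_closedBall_zero_iff, not_le] at hx
    exact max_eq_left ((min_le_right _ _).trans
      (div_nonpos_of_nonpos_of_nonneg (by linarith) hτ.le))
  have key : ∀ x y, x ∈ closedBall (0 : E) 1 →
      dist (χ x • w x) (χ y • w y) ≤ (1 + L) * dist x y := by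
    intro x y hx
    have : χ x • w x - χ y • w y = (χ x - χ y) • w x + χ y • (w x - w y) := by
      rw [sub_smul, smul_sub]; abel
    rw [dist_eq_norm, this, dist_eq_norm]
    refine (norm_add_le _ _).trans ?_
    rw [norm_smul, norm_smul, Real.norm_eq_abs, Real.norm_eq_abs, abs_of_nonneg (hχ0 y), add_mul,
      one_mul]
    have h1 : |χ x - χ y| * ‖w x‖ ≤ ‖x - y‖ :=
      (mul_le_mul_of_nonneg_left (hwb x hx) (abs_nonneg _)).trans (hχL x y)
    have h2 : ‖w x - w y‖ ≤ L * ‖x - y‖ := by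
      simpa only [dist_eq_norm] using hw.dist_le_mul x y
    have h3 : χ y * ‖w x - w y‖ ≤ ‖w x - w y‖ := mul_le_of_le_one_left (norm_nonneg _) (hχ1 y)
    linarith
  refine LipschitzWith.of_dist_le_mul fun x y => ?_
  rw [NNReal.coe_add, NNReal.coe_one]
  by_cases hx : x ∈ closedBall (0 : E) 1
  · exact key x y hx
  by_cases hy : y ∈ closedBall (0 : E) 1
  · rw [dist_comm, dist_comm x]
    exact key y x hy
  · change dist (χ x • w x) (χ y • w y) ≤ _
    rw [hχout x hx, hχout y hy, zero_smul, zero_smul, dist_self]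
    positivity

/-- A quantitative form of invariance of domain for Lipschitz maps: an `L`-Lipschitz map which is
uniformly close to the identity on the unit ball has an image of positive measure. -/
lemma exists_measure_image_pos (n : ℕ) (L : NNReal) :
    ∃ ε : ℝ, 0 < ε ∧ ∀ g : Euc n → Euc n, LipschitzWith L g →
      (∀ x ∈ closedBall (0 : Euc n) 1, ‖g x - x‖ ≤ ε) →
      (μH[n] : Measure (Euc n)) (g '' closedBall 0 1) ≠ 0 := by
  obtain ⟨C, hCM⟩ := exists_abs_det_le n (1 + (L + 1) : NNReal)
  obtain ⟨τ, hτ0, hτ1, hτ⟩ := exists_measure_annulus_lt n C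
  refine ⟨τ, hτ0, fun g hg hgid hnull => ?_⟩
  set μ : Measure (Euc n) := μH[n] with hμ
  have hu := lipschitzWith_cutoff hτ0 (hg.sub LipschitzWith.id) hgid
  set u : Euc n → Euc n := fun x => (max 0 (min 1 ((1 - ‖x‖) / τ))) • (g x - id x) with hu_def
  have hu0 : ∀ x, x ∉ closedBall (0 : Euc n) 1 → u x = 0 := by
    intro x hx
    rw [mem_closedBall_zero_iff, not_le] at hx
    have : max 0 (min 1 ((1 - ‖x‖) / τ)) = 0 := max_eq_left ((min_le_right _ _).trans
      (div_nonpos_of_nonpos_of_nonneg (by linarith) hτ0.le))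
    simp only [hu_def, this, zero_smul]
  have hug : ∀ x ∈ ball (0 : Euc n) (1 - τ), u x = g x - x := by
    intro x hx
    rw [mem_ball_zero_iff] at hx
    have : max 0 (min 1 ((1 - ‖x‖) / τ)) = 1 := by
      rw [min_eq_left, max_eq_right zero_le_one]
      rw [le_div_iff₀ hτ0]; linarith
    simp only [hu_def, this, one_smul, id]
  have h_int := integral_det_one_add_fderiv hu measurableSet_closedBall
    (measure_closedBall_lt_top (μ := μ)).ne hu0
  have hbsub : ball (0 : Euc n) (1 - τ) ⊆ closedBall 0 1 :=
    ball_subset_closedBall.trans (closedBall_subset_closedBall (by linarith))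
  have hintble : IntegrableOn (fun x => (1 + fderiv ℝ u x).det) (closedBall 0 1) μ := by
    simpa using integrableOn_det_one_add_fderiv hu
      (measure_closedBall_lt_top (μ := μ) (x := 0) (r := 1)).ne 1
  have hzero : ∫ x in ball (0 : Euc n) (1 - τ), (1 + fderiv ℝ u x).det ∂μ = 0 := by
    set s := ball (0 : Euc n) (1 - τ) ∩ ({x | DifferentiableAt ℝ g x} ∩
      {x | (fderiv ℝ g x).det ≠ 0}) with hs
    have hdetm : Measurable fun x => (fderiv ℝ g x).det :=
      ContinuousLinearMap.continuous_det.measurable.comp (measurable_fderiv ℝ g)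
    have hsm : MeasurableSet s := measurableSet_ball.inter
      ((measurableSet_of_differentiableAt ℝ g).inter
        (hdetm (measurableSet_singleton 0).compl))
    have hs0 : μ s = 0 := measure_det_ne_zero_of_image_null (g := g) (g' := fderiv ℝ g) hsm
      (fun x hx => hx.2.1.hasFDerivAt.hasFDerivWithinAt)
      (measure_mono_null (image_mono (inter_subset_left.trans hbsub)) hnull)
      (fun x hx => hx.2.2)
    have hd0 : μ {x | DifferentiableAt ℝ g x}ᶜ = 0 := ae_fderiv_of_lipschitz hg
    refine setIntegral_eq_zero_of_ae_eq_zero ?_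
    have h1 : ∀ᵐ x ∂μ, x ∉ s := measure_eq_zero_iff_ae_notMem.1 hs0
    have h2 : ∀ᵐ x ∂μ, DifferentiableAt ℝ g x := hd0
    filter_upwards [h1, h2] with x hx1 hx2 hx
    have hfd : fderiv ℝ u x = fderiv ℝ g x - 1 := by
      have : u =ᶠ[𝓝 x] fun y => g y - y := by
        filter_upwards [isOpen_ball.mem_nhds hx] with y hy using hug y hy
      rw [this.fderiv_eq]
      exact (hx2.hasFDerivAt.sub (hasFDerivAt_id x)).fderiv
    rw [hfd, add_sub_cancel]
    by_contra hne
    exact hx1 ⟨hx, hx2, hne⟩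
  have hsplit := setIntegral_sdiff measurableSet_ball hintble hbsub
  rw [h_int, hzero, sub_zero] at hsplit
  have hbound := norm_setIntegral_le_of_norm_le_const (μ := μ) (C := C)
    (s := closedBall (0 : Euc n) 1 \ ball 0 (1 - τ)) (f := fun x => (1 + fderiv ℝ u x).det)
    ((measure_mono sdiff_subset).trans_lt measure_closedBall_lt_top)
    (fun x _ => hCM _ (norm_fderiv_le_of_lipschitz ℝ hu))
  rw [hsplit, Real.norm_of_nonneg measureReal_nonneg] at hbound
  exact absurd hτ (not_lt.2 hbound)

lemma seminorm_le_mul_norm {n : ℕ} (p : Seminorm ℝ (Euc n)) :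
    ∃ C : ℝ, 0 < C ∧ ∀ x, p x ≤ C * ‖x‖ := by
  refine ⟨∑ i, p (EuclideanSpace.single i 1) + 1,
    by positivity, fun x => ?_⟩
  have hx : x = ∑ i, x i • EuclideanSpace.single i (1 : ℝ) := by
    simpa using ((EuclideanSpace.basisFun (Fin n) ℝ).sum_repr x).symm
  have h1 : p x ≤ ∑ i, p (x i • EuclideanSpace.single i (1 : ℝ)) := by
    nth_rw 1 [hx]
    exact Finset.le_sum_of_subadditive p (map_zero p).le (map_add_le_add p) _ _
  have h2 : ∀ i, p (x i • EuclideanSpace.single i (1 : ℝ))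
      ≤ p (EuclideanSpace.single i 1) * ‖x‖ := fun i => by
    rw [map_smul_eq_mul, mul_comm]
    exact mul_le_mul_of_nonneg_left (PiLp.norm_apply_le x i) (apply_nonneg _ _)
  rw [add_mul, Finset.sum_mul]
  have := Finset.sum_le_sum fun i (_ : i ∈ Finset.univ) => h2 i
  linarith [norm_nonneg x]

lemma seminorm_continuous {n : ℕ} (p : Seminorm ℝ (Euc n)) : Continuous p := by
  obtain ⟨C, hC, h⟩ := seminorm_le_mul_norm p
  exact Seminorm.continuous_of_le (q := C.toNNReal • normSeminorm ℝ (Euc n))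
    (by simpa using (continuous_norm.const_smul C.toNNReal)) fun x => by
      simpa [NNReal.smul_def, hC.le] using h x

/-- A point of the unit ball of a norm that is farthest from the origin. -/
lemma exists_farthest_point {m : ℕ} (hm : 0 < m) (p : Seminorm ℝ (Euc m))
    (hp : ∀ x, p x = 0 → x = 0) :
    ∃ e : Euc m, e ≠ 0 ∧ p e = 1 ∧ ∀ x, ‖x‖ ≤ ‖e‖ * p x := by
  have : Nonempty (Fin m) := ⟨⟨0, hm⟩⟩
  obtain ⟨z, hz, hmin⟩ := (isCompact_sphere (0 : Euc m) 1).exists_isMinOn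
    (NormedSpace.sphere_nonempty.2 zero_le_one) (seminorm_continuous p).continuousOn
  rw [mem_sphere_zero_iff_norm] at hz
  have hz0 : z ≠ 0 := fun h => by simp [h] at hz
  have hpz : 0 < p z := (apply_nonneg p z).lt_of_ne fun h => hz0 (hp z h.symm)
  refine ⟨(p z)⁻¹ • z, smul_ne_zero (inv_ne_zero hpz.ne') hz0, ?_, fun x => ?_⟩
  · rw [map_smul_eq_mul, norm_inv, Real.norm_of_nonneg hpz.le, inv_mul_cancel₀ hpz.ne']
  · rcases eq_or_ne x 0 with rfl | hx
    · simp
    have hx' : 0 < ‖x‖ := norm_pos_iff.2 hx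
    have h1 : p z ≤ p (‖x‖⁻¹ • x) := hmin (by
      rw [mem_sphere_zero_iff_norm, norm_smul, norm_inv, norm_norm, inv_mul_cancel₀ hx'.ne'])
    rw [map_smul_eq_mul, norm_inv, norm_norm, inv_mul_eq_div, le_div_iff₀ hx'] at h1
    rw [norm_smul, norm_inv, Real.norm_of_nonneg hpz.le, hz, mul_one, inv_mul_eq_div,
      le_div_iff₀ hpz, mul_comm]
    exact h1

lemma exists_dual_of_seminorm {n : ℕ} (p : Seminorm ℝ (Euc n)) {u : Euc n} (hu : p u = 1) :
    ∃ l : Euc n →L[ℝ] ℝ, l u = 1 ∧ ∀ x, |l x| ≤ p x := by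
  have hu0 : u ≠ 0 := fun h => by simp [h] at hu
  obtain ⟨g, hg, hgp⟩ := Module.Dual.exists_continuous_extension_of_le_seminorm_real
    (Submodule.span ℝ {u}) (LinearEquiv.coord ℝ (Euc n) u hu0).toLinearMap
    (seminorm_continuous p) (by
      intro y
      have h := LinearEquiv.coord_apply_smul ℝ (Euc n) u hu0 y
      rw [← h, map_smul_eq_mul, hu, mul_one]
      exact le_abs_self _)
  refine ⟨g, ?_, hgp⟩
  rw [hg ⟨u, Submodule.mem_span_singleton_self u⟩]
  exact LinearEquiv.coord_self ℝ (Euc n) u hu0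

lemma cube_eq_preimage (n : ℕ) :
    cube n = (fun x : Euc n => WithLp.ofLp x) ⁻¹' Set.Icc (fun _ => -1) (fun _ => 1) := by
  ext x
  simp only [cube, Set.mem_ofPred_eq, abs_le, Set.mem_preimage, Set.mem_Icc, Pi.le_def]
  exact forall_and

lemma convex_cube (n : ℕ) : Convex ℝ (cube n) := by
  rw [cube_eq_preimage]
  exact (convex_Icc _ _).linear_preimage (WithLp.linearEquiv 2 ℝ (Fin n → ℝ)).toLinearMap

lemma isCompact_cube (n : ℕ) : IsCompact (cube n) := by
  rw [cube_eq_preimage]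
  exact (PiLp.homeomorph 2 fun _ : Fin n => ℝ).isCompact_preimage.2 isCompact_Icc

lemma zero_mem_interior_cube (n : ℕ) : (0 : Euc n) ∈ interior (cube n) := by
  rw [mem_interior_iff_mem_nhds]
  refine Filter.mem_of_superset (closedBall_mem_nhds _ one_pos) fun x hx i => ?_
  exact (PiLp.norm_apply_le x i).trans (by simpa using hx)

instance compactSpace_cube (n : ℕ) : CompactSpace (cube n) :=
  isCompact_iff_compactSpace.1 (isCompact_cube n)

lemma isClosed_lipAB {n m : ℕ} (na : Seminorm ℝ (Euc n)) (nb : Seminorm ℝ (Euc m))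
    (D : Set (Euc n)) :
    IsClosed {f : BoundedContinuousFunction D (Euc m) |
      ∀ x y : D, nb (f x - f y) ≤ na ((x : Euc n) - (y : Euc n))} := by
  simp only [Set.ofPred_forall]
  refine isClosed_iInter fun x => isClosed_iInter fun y => ?_
  refine isClosed_le ((seminorm_continuous nb).comp ?_) continuous_const
  exact (continuous_eval_const x).sub
    (continuous_eval_const y)

lemma completeSpace_lipAB {n m : ℕ} (na : Seminorm ℝ (Euc n)) (nb : Seminorm ℝ (Euc m))
    (D : Set (Euc n)) : CompleteSpace (LipAB na nb D) :=
  (isClosed_lipAB na nb D).completeSpace_coe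

/-- The element of `LipAB` given by a map on the ambient space. -/
def lipABMk {n m : ℕ} {na : Seminorm ℝ (Euc n)} {nb : Seminorm ℝ (Euc m)} (F : Euc n → Euc m)
    (hF : Continuous F)
    (h : ∀ x ∈ cube n, ∀ y ∈ cube n, nb (F x - F y) ≤ na (x - y)) : LipAB na nb (cube n) :=
  ⟨BoundedContinuousFunction.mkOfCompact ⟨fun x => F x, hF.comp continuous_subtype_val⟩,
    fun x y => h x x.2 y y.2⟩

/-- Elements of `LipAB` extend to Lipschitz maps, with a uniform constant. -/
lemma exists_lipschitz_extension {n m : ℕ} (hm : 0 < m) (na : Seminorm ℝ (Euc n))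
    (nb : Seminorm ℝ (Euc m)) (hnb : ∀ x, nb x = 0 → x = 0) :
    ∃ K : NNReal, ∀ f : LipAB na nb (cube n), ∃ F : Euc n → Euc m, LipschitzWith K F ∧
      ∀ x : cube n, F x = f.1 x := by
  obtain ⟨C, hC, hCa⟩ := seminorm_le_mul_norm na
  obtain ⟨e, -, -, he⟩ := exists_farthest_point hm nb hnb
  refine ⟨lipschitzExtensionConstant (Euc m) * (‖e‖₊ * C.toNNReal), fun f => ?_⟩
  have hex : ∀ x : Euc n, ∃ y : Euc m, ∀ h : x ∈ cube n, y = f.1 ⟨x, h⟩ := fun x => by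
    by_cases h : x ∈ cube n
    · exact ⟨f.1 ⟨x, h⟩, fun _ => rfl⟩
    · exact ⟨0, fun h' => absurd h' h⟩
  choose F₀ hF₀ using hex
  have hL : LipschitzOnWith (‖e‖₊ * C.toNNReal) F₀ (cube n) := by
    refine LipschitzOnWith.of_dist_le_mul fun x hx y hy => ?_
    rw [hF₀ x hx, hF₀ y hy, dist_eq_norm, dist_eq_norm, NNReal.coe_mul, coe_nnnorm,
      Real.coe_toNNReal _ hC.le, mul_assoc]
    exact (he _).trans (mul_le_mul_of_nonneg_left ((f.2 _ _).trans (hCa _)) (norm_nonneg _))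
  obtain ⟨F, hF, hFE⟩ := hL.extend_finite_dimension
  exact ⟨F, hF, fun x => by rw [← hFE x.2, hF₀ x x.2]⟩

lemma range_eq_image_cube {n m : ℕ} {na : Seminorm ℝ (Euc n)} {nb : Seminorm ℝ (Euc m)}
    {f : LipAB na nb (cube n)} {F : Euc n → Euc m} (hF : ∀ x : cube n, F x = f.1 x) :
    Set.range ⇑f.1 = F '' cube n := by
  ext y
  constructor
  · rintro ⟨x, rfl⟩
    exact ⟨x, x.2, hF x⟩
  · rintro ⟨x, hx, rfl⟩
    exact ⟨⟨x, hx⟩, (hF ⟨x, hx⟩).symm⟩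

lemma seminorm_fderiv_le {n m : ℕ} {na : Seminorm ℝ (Euc n)} {nb : Seminorm ℝ (Euc m)}
    {f : LipAB na nb (cube n)} {F : Euc n → Euc m} (hF : ∀ x : cube n, F x = f.1 x)
    {x : Euc n} (hx : x ∈ interior (cube n)) {F' : Euc n →L[ℝ] Euc m} (hd : HasFDerivAt F F' x)
    (w : Euc n) : nb (F' w) ≤ na w := by
  have hlim : Tendsto (fun t : ℝ => t⁻¹ • (F (x + t • w) - F x)) (𝓝[>] 0) (𝓝 (F' w)) :=
    (hd.hasLineDerivAt w).tendsto_slope_zero_right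
  refine le_of_tendsto (((seminorm_continuous nb).tendsto _).comp hlim) ?_
  have hnear : ∀ᶠ t : ℝ in 𝓝[>] 0, x + t • w ∈ cube n := by
    have hc : Continuous fun t : ℝ => x + t • w := by fun_prop
    refine (hc.continuousAt.eventually_mem ?_).filter_mono nhdsWithin_le_nhds
    simpa using mem_interior_iff_mem_nhds.1 hx
  filter_upwards [hnear, self_mem_nhdsWithin] with t ht ht0
  have ht0 : 0 < t := ht0
  have h1 := f.2 ⟨_, ht⟩ ⟨x, interior_subset hx⟩
  rw [← hF, ← hF] at h1
  simp only [add_sub_cancel_left, map_smul_eq_mul, Real.norm_of_nonneg ht0.le] at h1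
  rw [Function.comp_apply, map_smul_eq_mul, norm_inv, Real.norm_of_nonneg ht0.le,
    inv_mul_le_iff₀ ht0]
  exact h1

lemma norm_sub_le_dist_lipAB {n m : ℕ} {na : Seminorm ℝ (Euc n)} {nb : Seminorm ℝ (Euc m)}
    (f g : LipAB na nb (cube n)) (x : cube n) : ‖f.1 x - g.1 x‖ ≤ dist f g := by
  rw [← dist_eq_norm]
  exact BoundedContinuousFunction.dist_coe_le_dist x

lemma exists_ball_measure_range_ne_zero {n m : ℕ} (hm : 0 < m) {na : Seminorm ℝ (Euc n)}
    {nb : Seminorm ℝ (Euc m)} (hnb : ∀ x, nb x = 0 → x = 0) {h : LipAB na nb (cube n)}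
    {H : Euc n → Euc m} (hH : ∀ x : cube n, H x = h.1 x) {x₀ : Euc n}
    (hx₀ : x₀ ∈ interior (cube n)) {A : Euc n →L[ℝ] Euc m} (hA : HasFDerivAt H A x₀)
    (hinj : Function.Injective A) :
    ∃ ρ > 0, ∀ g ∈ ball h ρ, (μH[n] : Measure (Euc m)) (Set.range g.1) ≠ 0 := by
  obtain ⟨K, hK⟩ := exists_lipschitz_extension hm na nb hnb
  obtain ⟨P₀, hP₀⟩ := A.toLinearMap.exists_leftInverse_of_injective (LinearMap.ker_eq_bot.2 hinj)
  set P : Euc m →L[ℝ] Euc n := P₀.toContinuousLinearMap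
  have hPA : ∀ x, P (A x) = x := fun x => LinearMap.congr_fun hP₀ x
  obtain ⟨ε, hε, hεg⟩ := exists_measure_image_pos n (‖P‖₊ * K)
  set c := ε / (2 * (‖P‖ + 1)) with hc
  have hP1 : 0 < ‖P‖ + 1 := by positivity
  have hc0 : 0 < c := by positivity
  have hcP : 2 * c * ‖P‖ ≤ ε := by
    have : 2 * c * (‖P‖ + 1) = ε := by rw [hc]; field_simp
    nlinarith
  have hev : ∀ᶠ x in 𝓝 x₀, x ∈ cube n ∧ ‖H x - H x₀ - A (x - x₀)‖ ≤ c * ‖x - x₀‖ :=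
    (eventually_mem_set.2 (mem_interior_iff_mem_nhds.1 hx₀)).and (hA.isLittleO.def hc0)
  obtain ⟨r, hr, hrx⟩ := nhds_basis_closedBall.eventually_iff.1 hev
  refine ⟨c * r, by positivity, fun g hg h0 => ?_⟩
  rw [mem_ball] at hg
  obtain ⟨G, hGL, hG⟩ := hK g
  have hmem : ∀ z ∈ closedBall (0 : Euc n) 1, x₀ + r • z ∈ closedBall x₀ r := fun z hz => by
    rw [mem_closedBall_zero_iff] at hz
    rw [mem_closedBall, dist_eq_norm, add_sub_cancel_left, norm_smul, Real.norm_of_nonneg hr.le]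
    exact mul_le_of_le_one_right hr.le hz
  refine hεg (fun z => r⁻¹ • P (G (x₀ + r • z) - H x₀)) ?_ (fun z hz => ?_) ?_
  · refine LipschitzWith.of_dist_le_mul fun z w => ?_
    rw [dist_eq_norm, dist_eq_norm, ← smul_sub, ← map_sub, sub_sub_sub_cancel_right, norm_smul,
      norm_inv, Real.norm_of_nonneg hr.le, inv_mul_le_iff₀ hr]
    refine (P.le_opNorm _).trans ?_
    have h1 := hGL.dist_le_mul (x₀ + r • z) (x₀ + r • w)
    rw [dist_eq_norm, dist_eq_norm, add_sub_add_left_eq_sub, ← smul_sub, norm_smul,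
      Real.norm_of_nonneg hr.le] at h1
    have h2 := mul_le_mul_of_nonneg_left h1 (norm_nonneg P)
    rw [NNReal.coe_mul, coe_nnnorm]
    linarith
  · obtain ⟨hzc, hzH⟩ := hrx (hmem z hz)
    have h1 : r⁻¹ • P (G (x₀ + r • z) - H x₀) - z
        = r⁻¹ • P ((g.1 ⟨_, hzc⟩ - h.1 ⟨_, hzc⟩) +
          (H (x₀ + r • z) - H x₀ - A (x₀ + r • z - x₀))) := by
      rw [← hG, ← hH, add_sub_cancel_left, map_smul A, ← add_sub_assoc, map_sub P _ (r • A z),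
        map_smul P, hPA, smul_sub, inv_smul_smul₀ hr.ne']
      congr 3
      abel
    rw [h1, norm_smul, norm_inv, Real.norm_of_nonneg hr.le, inv_mul_le_iff₀ hr]
    refine (P.le_opNorm _).trans ?_
    have h2 : ‖x₀ + r • z - x₀‖ ≤ r := by simpa [dist_eq_norm] using hmem z hz
    have h3 : ‖(g.1 ⟨_, hzc⟩ - h.1 ⟨_, hzc⟩) + (H (x₀ + r • z) - H x₀ - A (x₀ + r • z - x₀))‖
        ≤ 2 * c * r := by
      refine (norm_add_le _ _).trans ?_
      have h4 := norm_sub_le_dist_lipAB g h ⟨_, hzc⟩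
      have h5 := mul_le_mul_of_nonneg_left h2 hc0.le
      linarith
    have h6 := mul_le_mul_of_nonneg_left h3 (norm_nonneg P)
    have h7 := mul_le_mul_of_nonneg_left hcP hr.le
    linarith
  · have hψ : LipschitzWith (‖r⁻¹‖₊ * ‖P‖₊) fun y => r⁻¹ • P (y - H x₀) := by
      refine LipschitzWith.of_dist_le_mul fun y w => ?_
      rw [dist_eq_norm, dist_eq_norm, ← smul_sub, ← map_sub, sub_sub_sub_cancel_right, norm_smul,
        NNReal.coe_mul, coe_nnnorm, coe_nnnorm, mul_assoc]
      exact mul_le_mul_of_nonneg_left (P.le_opNorm _) (norm_nonneg _)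
    have hsub : (fun z => r⁻¹ • P (G (x₀ + r • z) - H x₀)) '' closedBall 0 1
        ⊆ (fun y => r⁻¹ • P (y - H x₀)) '' Set.range g.1 := by
      rintro _ ⟨z, hz, rfl⟩
      exact ⟨G (x₀ + r • z), ⟨⟨_, (hrx (hmem z hz)).1⟩, (hG _).symm⟩, rfl⟩
    refine measure_mono_null hsub (le_antisymm ?_ bot_le)
    refine (hψ.hausdorffMeasure_image_le n.cast_nonneg _).trans ?_
    rw [h0, mul_zero]

lemma exists_linear_contraction_with_leftInverse {n m : ℕ} (hn : 0 < n) (hnm : n ≤ m)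
    (na : Seminorm ℝ (Euc n)) (hna : ∀ x, na x = 0 → x = 0) (nb : Seminorm ℝ (Euc m)) :
    ∃ (T : Euc n →L[ℝ] Euc m) (P : Euc m →L[ℝ] Euc n) (c : ℝ), 0 < c ∧
      (∀ x, P (T x) = c • x) ∧ ∀ x, nb (T x) ≤ na x := by
  set P₀ : Euc m →ₗ[ℝ] Euc n := (WithLp.linearEquiv 2 ℝ (Fin n → ℝ)).symm.toLinearMap ∘ₗ
    LinearMap.funLeft ℝ ℝ (Fin.castLE hnm) ∘ₗ (WithLp.linearEquiv 2 ℝ (Fin m → ℝ)).toLinearMap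
  have hsurj : Function.Surjective P₀ :=
    (WithLp.linearEquiv 2 ℝ (Fin n → ℝ)).symm.surjective.comp
      ((LinearMap.funLeft_surjective_of_injective ℝ ℝ _ (Fin.castLE_injective hnm)).comp
        (WithLp.linearEquiv 2 ℝ (Fin m → ℝ)).surjective)
  obtain ⟨T₀, hT₀⟩ := P₀.exists_rightInverse_of_surjective (LinearMap.range_eq_top.2 hsurj)
  obtain ⟨C, hC, hCb⟩ := seminorm_le_mul_norm nb
  obtain ⟨e, -, -, he⟩ := exists_farthest_point hn na hna
  set T : Euc n →L[ℝ] Euc m := T₀.toContinuousLinearMap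
  have hD : 0 < C * ‖T‖ * ‖e‖ + 1 := by positivity
  set c := (C * ‖T‖ * ‖e‖ + 1)⁻¹ with hc
  have hc0 : 0 < c := inv_pos.2 hD
  refine ⟨c • T, P₀.toContinuousLinearMap, c, hc0, fun x => ?_, fun x => ?_⟩
  · change P₀ (c • T₀ x) = c • x
    rw [map_smul]
    exact congrArg (c • ·) (LinearMap.congr_fun hT₀ x)
  · rw [_root_.smul_apply, map_smul_eq_mul, Real.norm_of_nonneg hc0.le, hc,
      inv_mul_le_iff₀ hD]
    have h1 : nb (T x) ≤ C * (‖T‖ * (‖e‖ * na x)) :=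
      (hCb _).trans (mul_le_mul_of_nonneg_left ((T.le_opNorm x).trans
        (mul_le_mul_of_nonneg_left (he x) (norm_nonneg _))) hC.le)
    have := apply_nonneg na x
    linarith

lemma exists_near_injective_fderiv {n m : ℕ} (hn : 0 < n) (hnm : n ≤ m)
    {na : Seminorm ℝ (Euc n)} (hna : ∀ x, na x = 0 → x = 0)
    {nb : Seminorm ℝ (Euc m)} (hnb : ∀ x, nb x = 0 → x = 0) (f : LipAB na nb (cube n))
    {δ : ℝ} (hδ : 0 < δ) :
    ∃ h ∈ ball f δ, ∃ (H : Euc n → Euc m) (x₀ : Euc n) (A : Euc n →L[ℝ] Euc m),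
      (∀ x : cube n, H x = h.1 x) ∧ x₀ ∈ interior (cube n) ∧ HasFDerivAt H A x₀ ∧
      Function.Injective A := by
  obtain ⟨K, hK⟩ := exists_lipschitz_extension (hn.trans_le hnm) na nb hnb
  obtain ⟨G, hGL, hG⟩ := hK f
  obtain ⟨T, P, c, hc, hPT, hT⟩ := exists_linear_contraction_with_leftInverse hn hnm na hna nb
  obtain ⟨x₀, hx₀, hd⟩ : ∃ x₀ ∈ interior (cube n), DifferentiableAt ℝ G x₀ := by
    by_contra! hcon
    refine (isOpen_interior.measure_pos (μH[n] : Measure (Euc n))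
      ⟨0, zero_mem_interior_cube n⟩).ne' ?_
    exact measure_mono_null (fun x hx => hcon x hx) (ae_fderiv_of_lipschitz hGL)
  set A := fderiv ℝ G x₀
  obtain ⟨B, hB⟩ := (isCompact_cube n).exists_bound_of_continuousOn
    (f := fun x => T x - G x) (by have := hGL.continuous; fun_prop)
  have hB0 : 0 ≤ B := (norm_nonneg _).trans (hB 0 (interior_subset (zero_mem_interior_cube n)))
  set S := P.toLinearMap ∘ₗ A.toLinearMap
  have hfin : {t : ℝ | Module.End.HasEigenvalue S (-(t * c))}.Finite :=
    (Module.End.finite_hasEigenvalue S).preimage fun s _ t _ hst => by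
      simpa [hc.ne'] using hst
  obtain ⟨t, ⟨ht0, htδ⟩, htS⟩ := (Ioo_infinite (show 0 < δ / (B + 1) by positivity)
    ).exists_notMem_finite hfin
  have ht1 : 0 < 1 + t := by linarith
  set H : Euc n → Euc m := fun x => (1 + t)⁻¹ • (G x + t • T x)
  have hHL : ∀ x ∈ cube n, ∀ y ∈ cube n, nb (H x - H y) ≤ na (x - y) := fun x hx y hy => by
    have h1 : H x - H y = (1 + t)⁻¹ • ((G x - G y) + t • T (x - y)) := by
      simp only [H, map_sub]; module
    have h2 : nb (G x - G y) ≤ na (x - y) := by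
      rw [hG ⟨x, hx⟩, hG ⟨y, hy⟩]; exact f.2 _ _
    have h3 := map_add_le_add nb (G x - G y) (t • T (x - y))
    rw [map_smul_eq_mul, Real.norm_of_nonneg ht0.le] at h3
    have h4 := mul_le_mul_of_nonneg_left (hT (x - y)) ht0.le
    rw [h1, map_smul_eq_mul, norm_inv, Real.norm_of_nonneg ht1.le, inv_mul_le_iff₀ ht1]
    linarith
  have hHc : Continuous H := by have := hGL.continuous; fun_prop
  have hHd : HasFDerivAt H ((1 + t)⁻¹ • (A + t • T)) x₀ :=
    (hd.hasFDerivAt.add (T.hasFDerivAt.const_smul t)).const_smul (1 + t)⁻¹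
  refine ⟨lipABMk H hHc hHL, ?_, H, x₀, (1 + t)⁻¹ • (A + t • T), fun _ => rfl, hx₀,
    hHd, ?_⟩
  · rw [mem_ball]
    have htB : t * (B + 1) < δ := by rwa [lt_div_iff₀ (by positivity)] at htδ
    refine lt_of_le_of_lt ?_ (show t * B < δ by linarith)
    refine (BoundedContinuousFunction.dist_le (by positivity)).2 fun x => ?_
    change dist (H x) (f.1 x) ≤ _
    have h1 : H x - f.1 x = (1 + t)⁻¹ • (t • (T x - G x)) := by
      rw [← hG, eq_inv_smul_iff₀ ht1.ne', smul_sub, smul_inv_smul₀ ht1.ne']; module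
    rw [dist_eq_norm, h1, norm_smul, norm_smul, norm_inv, Real.norm_of_nonneg ht1.le,
      Real.norm_of_nonneg ht0.le, inv_mul_le_iff₀ ht1]
    have h2 := mul_le_mul_of_nonneg_left (hB x x.2) ht0.le
    have h3 : 0 ≤ t * (t * B) := by positivity
    linarith
  · refine (injective_iff_map_eq_zero _).2 fun x hx => ?_
    by_contra hx0
    refine htS ?_
    have h1 : A x + t • T x = 0 :=
      (smul_eq_zero.1 (show (1 + t)⁻¹ • (A x + t • T x) = 0 from hx)).resolve_left
        (inv_ne_zero ht1.ne')
    refine Module.End.hasEigenvalue_of_hasEigenvector (x := x) ⟨?_, hx0⟩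
    rw [Module.End.mem_eigenspace_iff]
    change P (A x) = _
    rw [eq_neg_of_add_eq_zero_left h1, map_neg, map_smul, hPT, neg_smul, smul_smul]

/-- Generic `1`-Lipschitz maps of the cube have an image of positive measure. -/
lemma residual_measure_range_pos {n m : ℕ} (hn : 0 < n) (hnm : n ≤ m)
    {na : Seminorm ℝ (Euc n)} (hna : ∀ x, na x = 0 → x = 0)
    {nb : Seminorm ℝ (Euc m)} (hnb : ∀ x, nb x = 0 → x = 0) :
    {f : LipAB na nb (cube n) | 0 < (μH[n] : Measure (Euc m)) (Set.range f.1)}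
      ∈ residual (LipAB na nb (cube n)) := by
  refine Filter.mem_of_superset (residual_of_dense_open isOpen_interior ?_) interior_subset
  refine Metric.dense_iff.2 fun f δ hδ => ?_
  obtain ⟨h, hhf, H, x₀, A, hH, hx₀, hA, hinj⟩ := exists_near_injective_fderiv hn hnm hna hnb f hδ
  obtain ⟨ρ, hρ, hg⟩ := exists_ball_measure_range_ne_zero (hn.trans_le hnm) hnb hH hx₀ hA hinj
  exact ⟨h, hhf, mem_interior_iff_mem_nhds.2
    (Filter.mem_of_superset (ball_mem_nhds h hρ) fun g hgm => (hg g hgm).bot_lt)⟩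

/-- The linear map multiplying the direction of a unit vector `v` by `η`. -/
def contractAlong {n : ℕ} (v : Euc n) (η : ℝ) : Euc n →ₗ[ℝ] Euc n :=
  LinearMap.transvection ((η - 1) • (innerSL ℝ v).toLinearMap) v

lemma contractAlong_apply {n : ℕ} (v : Euc n) (η : ℝ) (x : Euc n) :
    contractAlong v η x = x + ((η - 1) * inner ℝ v x) • v := rfl

lemma det_contractAlong {n : ℕ} {v : Euc n} (hv : ‖v‖ = 1) (η : ℝ) :
    (contractAlong v η).det = η := by
  rw [contractAlong, LinearMap.transvection.det]
  change 1 + (η - 1) * inner ℝ v v = η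
  rw [real_inner_self_eq_norm_sq, hv]
  ring

lemma norm_map_le_mul_norm_contractAlong {n m : ℕ} {v : Euc n} (hv : ‖v‖ = 1) {η : ℝ}
    (hη : 0 < η) (hη1 : η ≤ 1) {K : ℝ} {A : Euc n →L[ℝ] Euc m} (hA : ‖A‖ ≤ K)
    (hAv : ‖A v‖ ≤ η) (w : Euc n) :
    ‖A w‖ + η * ‖w‖ ≤ (K + 3) * ‖contractAlong v η w‖ := by
  set a := inner ℝ v w with ha
  set p := w - a • v with hp
  have hw : w = p + a • v := by rw [hp]; abel
  have hvv : inner ℝ v v = (1 : ℝ) := by rw [real_inner_self_eq_norm_sq, hv]; norm_num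
  have hpv : inner ℝ p v = (0 : ℝ) := by
    rw [hp, inner_sub_left, real_inner_smul_left, hvv, real_inner_comm, ← ha]; ring
  have hD : contractAlong v η w = p + (η * a) • v := by
    rw [contractAlong_apply, ← ha, hp]; module
  have hsq : ‖p + (η * a) • v‖ ^ 2 = ‖p‖ ^ 2 + (η * |a|) ^ 2 := by
    rw [norm_add_sq_real, real_inner_smul_right, hpv, norm_smul, hv, Real.norm_eq_abs, abs_mul,
      abs_of_pos hη]
    ring
  rw [hD]
  set d := ‖p + (η * a) • v‖
  have hd0 : 0 ≤ d := norm_nonneg _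
  have h1 : ‖p‖ ≤ d := le_of_sq_le_sq (by nlinarith [sq_nonneg (η * |a|)]) hd0
  have h2 : η * |a| ≤ d := le_of_sq_le_sq (by nlinarith [sq_nonneg ‖p‖]) hd0
  have hK : 0 ≤ K := (norm_nonneg _).trans hA
  have h3 : ‖A w‖ ≤ K * ‖p‖ + η * |a| := by
    rw [hw, map_add, map_smul]
    refine (norm_add_le _ _).trans (add_le_add ((A.le_opNorm p).trans
      (mul_le_mul_of_nonneg_right hA (norm_nonneg _))) ?_)
    rw [norm_smul, Real.norm_eq_abs, mul_comm]
    exact mul_le_mul_of_nonneg_right hAv (abs_nonneg _)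
  have h4 : ‖w‖ ≤ ‖p‖ + |a| := by
    conv_lhs => rw [hw]
    refine (norm_add_le _ _).trans (add_le_add le_rfl ?_)
    rw [norm_smul, hv, mul_one, Real.norm_eq_abs]
  have h5 := mul_le_mul_of_nonneg_left h4 hη.le
  have h6 := mul_le_mul_of_nonneg_left h1 hK
  have h7 : η * ‖p‖ ≤ ‖p‖ := mul_le_of_le_one_left (norm_nonneg _) hη1
  linarith

lemma measure_image_le_of_approximatesLinearOn {n m : ℕ} {v : Euc n} (hv : ‖v‖ = 1)
    {η : NNReal} (hη : 0 < η) (hη1 : η ≤ 1) {K : NNReal} {A : Euc n →L[ℝ] Euc m} (hA : ‖A‖ ≤ K)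
    (hAv : ‖A v‖ ≤ η) {G : Euc n → Euc m} {S : Set (Euc n)} (hG : ApproximatesLinearOn G A S η) :
    (μH[n] : Measure (Euc m)) (G '' S)
      ≤ ((K + 3 : NNReal) : ℝ≥0∞) ^ n * η * (μH[n] : Measure (Euc n)) S := by
  set D := contractAlong v (η : ℝ)
  have hη' : (0 : ℝ) < η := hη
  have hdist : ∀ x ∈ S, ∀ y ∈ S, ‖G x - G y‖ ≤ (K + 3) * ‖D x - D y‖ := fun x hx y hy => by
    have h1 := hG x hx y hy
    have h2 := norm_map_le_mul_norm_contractAlong hv hη' hη1 hA hAv (x - y)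
    have h3 := norm_sub_norm_le (G x - G y) (A (x - y))
    rw [map_sub (contractAlong v (η : ℝ))] at h2
    linarith
  have hinj : Function.Injective D := by
    have hu : IsUnit D.det := by rw [det_contractAlong hv]; exact hη'.ne'.isUnit
    exact (LinearMap.equivOfDetNeZero D hu.ne_zero).injective
  have hlip : LipschitzOnWith (K + 3) (G ∘ Function.invFun D) (D '' S) := by
    refine LipschitzOnWith.of_dist_le_mul ?_
    rintro _ ⟨x, hx, rfl⟩ _ ⟨y, hy, rfl⟩
    simp only [Function.comp_apply, Function.leftInverse_invFun hinj _, dist_eq_norm]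
    exact hdist x hx y hy
  have himg : G '' S = (G ∘ Function.invFun D) '' (D '' S) := by
    rw [← Set.image_comp]
    refine Set.image_congr fun x _ => ?_
    simp only [Function.comp_apply, Function.leftInverse_invFun hinj _]
  have h := hlip.hausdorffMeasure_image_le (d := n) n.cast_nonneg
  rw [himg]
  refine h.trans_eq ?_
  rw [Measure.addHaar_image_linearMap, det_contractAlong hv, abs_of_pos hη', ENNReal.rpow_natCast,
    ENNReal.ofReal_coe_nnreal, mul_assoc]

/-- The image of a set under a map whose derivative is small in a fixed direction is small. -/
lemma measure_image_le_of_fderiv_small {n m : ℕ} {v : Euc n} (hv : ‖v‖ = 1)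
    {η : NNReal} (hη : 0 < η) (hη1 : η ≤ 1) {K : NNReal} {G : Euc n → Euc m} {S : Set (Euc n)}
    (hd : ∀ x ∈ S, DifferentiableAt ℝ G x) (hK : ∀ x ∈ S, ‖fderiv ℝ G x‖ ≤ K)
    (hGv : ∀ x ∈ S, ‖fderiv ℝ G x v‖ ≤ η) :
    (μH[n] : Measure (Euc m)) (G '' S)
      ≤ ((K + 3 : NNReal) : ℝ≥0∞) ^ n * η * (μH[n] : Measure (Euc n)) S := by
  rcases S.eq_empty_or_nonempty with rfl | hS
  · simp
  obtain ⟨t, A, htd, htm, hSt, happ, hA⟩ :=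
    exists_partition_approximatesLinearOn_of_hasFDerivWithinAt G S (fderiv ℝ G)
      (fun x hx => (hd x hx).hasFDerivAt.hasFDerivWithinAt) (fun _ => η) fun _ => hη.ne'
  have hsub : G '' S ⊆ ⋃ k, G '' (S ∩ t k) := by
    rw [← Set.image_iUnion, ← Set.inter_iUnion]
    exact Set.image_mono (Set.subset_inter Subset.rfl hSt)
  calc (μH[n] : Measure (Euc m)) (G '' S) ≤ ∑' k, (μH[n] : Measure (Euc m)) (G '' (S ∩ t k)) :=
        (measure_mono hsub).trans (measure_iUnion_le _)
    _ ≤ ∑' k, ((K + 3 : NNReal) : ℝ≥0∞) ^ n * η * (μH[n] : Measure (Euc n)) (S ∩ t k) := by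
        refine ENNReal.tsum_le_tsum fun k => ?_
        obtain ⟨y, hy, hAy⟩ := hA hS k
        exact measure_image_le_of_approximatesLinearOn hv hη hη1 (hAy ▸ hK y hy)
          (hAy ▸ hGv y hy) (happ k)
    _ = ((K + 3 : NNReal) : ℝ≥0∞) ^ n * η *
          ∑' k, (μH[n] : Measure (Euc n)).restrict S (t k) := by
        rw [ENNReal.tsum_mul_left]
        congr 2
        exact funext fun k => by rw [Measure.restrict_apply (htm k), Set.inter_comm]
    _ ≤ _ := by
        rw [← measure_iUnion htd htm]
        refine mul_le_mul_right ((measure_mono (Set.subset_univ _)).trans_eq ?_) _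
        exact Measure.restrict_apply_univ S

/-- A uniformly small function that is nonincreasing in the direction `u` has small derivative in
that direction on most of the space. -/
lemma mul_measureReal_lineDeriv_le {E : Type*} [NormedAddCommGroup E] [NormedSpace ℝ E]
    [FiniteDimensional ℝ E] [MeasurableSpace E] [BorelSpace E] {μ : Measure E}
    [μ.IsAddHaarMeasure] {C D : NNReal} {φ ψ : E → ℝ} (hφ : LipschitzWith C φ)
    (hψ : LipschitzWith D ψ) (hc : HasCompactSupport ψ) (hψ0 : ∀ x, 0 ≤ ψ x) {ε : ℝ}
    (hb : ∀ x ∈ tsupport ψ, |φ x| ≤ ε) (u : E)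
    (hu : ∀ᵐ x ∂μ, x ∈ tsupport ψ → lineDeriv ℝ φ x u ≤ 0) (δ : ℝ) :
    δ * μ.real {x | δ ≤ -(lineDeriv ℝ φ x u * ψ x)} ≤ D * ‖u‖ * ε * μ.real (tsupport ψ) := by
  have h_int : Integrable (fun x => lineDeriv ℝ φ x u * ψ x) μ :=
    (hφ.locallyIntegrable_lineDeriv u).integrable_smul_right_of_hasCompactSupport hψ.continuous hc
  have hnn : 0 ≤ᵐ[μ] fun x => -(lineDeriv ℝ φ x u * ψ x) := by
    filter_upwards [hu] with x hx
    by_cases hxt : x ∈ tsupport ψ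
    · exact neg_nonneg.2 (mul_nonpos_of_nonpos_of_nonneg (hx hxt) (hψ0 x))
    · simp [image_eq_zero_of_notMem_tsupport hxt]
  refine (mul_meas_ge_le_integral_of_nonneg hnn h_int.neg δ).trans ?_
  rw [integral_neg, hφ.integral_lineDeriv_mul_eq hψ hc u]
  refine (neg_le_abs _).trans ?_
  rw [← setIntegral_eq_integral_of_forall_compl_eq_zero (s := tsupport ψ) fun x hx => ?_,
    ← Real.norm_eq_abs]
  · refine norm_setIntegral_le_of_norm_le_const hc.isCompact.measure_lt_top fun x hx => ?_
    rw [norm_mul]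
    refine mul_le_mul ?_ (hb x hx) (norm_nonneg _) (by positivity)
    simpa using norm_lineDeriv_le_of_lipschitz ℝ hψ (x₀ := x) (v := -u)
  · have h0 : ψ =ᶠ[𝓝 x] fun _ => 0 := notMem_tsupport_iff_eventuallyEq.1 hx
    have h1 : lineDeriv ℝ ψ x (-u) = 0 := by
      rw [h0.lineDeriv_eq]
      simp only [lineDeriv, deriv_const]
    simp only [h1, zero_mul]

lemma exists_cutoff_of_isCompact {n : ℕ} {S U : Set (Euc n)} (hS : IsCompact S) (hU : IsOpen U)
    (hb : Bornology.IsBounded U) (hSU : S ⊆ U) :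
    ∃ (D : NNReal) (ψ : Euc n → ℝ), LipschitzWith D ψ ∧ HasCompactSupport ψ ∧ (∀ x, 0 ≤ ψ x) ∧
      tsupport ψ ⊆ U ∧ ∀ x ∈ S, ψ x = 1 := by
  obtain ⟨r, hr, hrU⟩ := hS.exists_cthickening_subset_open hU hSU
  have hsupp : tsupport (fun x => (thickenedIndicator hr S x : ℝ)) ⊆ cthickening r S := by
    refine closure_minimal (fun x hx => ?_) isClosed_cthickening
    by_contra hxc
    refine hx ?_
    beta_reduce
    rw [thickenedIndicator_zero hr S fun h => hxc (thickening_subset_cthickening _ _ h)]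
    rfl
  refine ⟨r.toNNReal⁻¹, fun x => thickenedIndicator hr S x, ?_, ?_, fun x => NNReal.coe_nonneg _,
    hsupp.trans hrU, fun x hx => ?_⟩
  · exact LipschitzWith.of_dist_le_mul fun x y =>
      (lipschitzWith_thickenedIndicator hr S).dist_le_mul x y
  · exact Metric.isCompact_of_isClosed_isBounded (isClosed_tsupport _)
      (hb.subset (hsupp.trans hrU))
  · beta_reduce
    rw [thickenedIndicator_one hr S hx]
    rfl

lemma exists_compact_subset_interior_cube (n : ℕ) {θ : ℝ≥0∞} (hθ : θ ≠ 0) :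
    ∃ S : Set (Euc n), IsCompact S ∧ S ⊆ interior (cube n) ∧
      (μH[n] : Measure (Euc n)) (cube n \ S) ≤ θ := by
  obtain ⟨S, hSU, hS, hlt⟩ := isOpen_interior.measurableSet.exists_isCompact_sdiff_lt
    (μ := (μH[n] : Measure (Euc n)))
    ((measure_mono interior_subset).trans_lt (isCompact_cube n).measure_lt_top).ne hθ
  refine ⟨S, hS, hSU, ?_⟩
  have hsub : cube n \ S ⊆ frontier (cube n) ∪ (interior (cube n) \ S) := fun x ⟨hx, hxS⟩ => by
    by_cases hxi : x ∈ interior (cube n)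
    · exact Or.inr ⟨hxi, hxS⟩
    · exact Or.inl ⟨subset_closure hx, hxi⟩
  refine (measure_mono hsub).trans ((measure_union_le _ _).trans ?_)
  rw [(convex_cube n).addHaar_frontier (μH[n] : Measure (Euc n)), zero_add]
  exact hlt.le

/-- If `±b` can be added to `a` inside a ball of radius `r`, and `a` is nearly of norm `r`, then `b`
is small. -/
lemma norm_sq_le_of_norm_add_sub_le {V : Type*} [NormedAddCommGroup V] [InnerProductSpace ℝ V]
    {e a b : V} {δ : ℝ} (hδ : δ ≤ 1) (he : e ≠ 0) (hadd : ‖a + b‖ ≤ ‖e‖) (hsub : ‖a - b‖ ≤ ‖e‖)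
    (ha : (1 - δ) * ‖e‖ ^ 2 ≤ inner ℝ e a) : ‖b‖ ^ 2 ≤ 2 * δ * ‖e‖ ^ 2 := by
  have he0 : 0 < ‖e‖ := norm_pos_iff.2 he
  have hp := parallelogram_law_with_norm ℝ a b
  have h1 : (1 - δ) * ‖e‖ ≤ ‖a‖ := by
    have := ha.trans (real_inner_le_norm e a)
    rw [sq, ← mul_assoc, mul_comm ‖e‖ ‖a‖] at this
    exact le_of_mul_le_mul_right this he0
  have h2 : ((1 - δ) * ‖e‖) ^ 2 ≤ ‖a‖ ^ 2 :=
    pow_le_pow_left₀ (mul_nonneg (by linarith) he0.le) h1 2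
  have h3 : ‖a + b‖ ^ 2 ≤ ‖e‖ ^ 2 := pow_le_pow_left₀ (norm_nonneg _) hadd 2
  have h4 : ‖a - b‖ ^ 2 ≤ ‖e‖ ^ 2 := pow_le_pow_left₀ (norm_nonneg _) hsub 2
  nlinarith [mul_nonneg (sq_nonneg δ) (sq_nonneg ‖e‖)]

/-- The functional `y ↦ ⟪e, y⟫ / ‖e‖ ^ 2`. -/
def dualVec {m : ℕ} (e : Euc m) : Euc m →L[ℝ] ℝ := (‖e‖ ^ 2)⁻¹ • innerSL ℝ e

lemma dualVec_apply {m : ℕ} (e y : Euc m) : dualVec e y = (‖e‖ ^ 2)⁻¹ * inner ℝ e y := rfl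

lemma abs_dualVec_le {m : ℕ} {e : Euc m} (he : e ≠ 0) (y : Euc m) :
    |dualVec e y| ≤ ‖y‖ / ‖e‖ := by
  have he0 : 0 < ‖e‖ := norm_pos_iff.2 he
  rw [dualVec_apply, abs_mul, abs_of_pos (by positivity), inv_mul_le_iff₀ (by positivity)]
  refine (abs_real_inner_le_norm e y).trans_eq ?_
  field_simp

lemma dualVec_self {m : ℕ} {e : Euc m} (he : e ≠ 0) : dualVec e e = 1 := by
  rw [dualVec_apply, real_inner_self_eq_norm_sq, inv_mul_cancel₀]
  exact pow_ne_zero 2 (norm_ne_zero_iff.2 he)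

lemma dualVec_le_seminorm {m : ℕ} {nb : Seminorm ℝ (Euc m)} {e : Euc m} (he : e ≠ 0)
    (hfar : ∀ x, ‖x‖ ≤ ‖e‖ * nb x) (y : Euc m) : dualVec e y ≤ nb y := by
  have he0 : 0 < ‖e‖ := norm_pos_iff.2 he
  refine (le_abs_self _).trans ((abs_dualVec_le he y).trans ?_)
  rw [div_le_iff₀ he0, mul_comm]
  exact hfar y

lemma hasLineDerivAt_dualVec_comp_sub {n m : ℕ} (e : Euc m) (l : Euc n →L[ℝ] ℝ)
    {G : Euc n → Euc m} {x : Euc n} (hd : DifferentiableAt ℝ G x) (u : Euc n) :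
    HasLineDerivAt ℝ (fun x => dualVec e (G x) - l x) (dualVec e (fderiv ℝ G x u) - l u) x u :=
  (((dualVec e).hasFDerivAt.comp x hd.hasFDerivAt).sub l.hasFDerivAt).hasLineDerivAt u

/-- Covering of the image of the cube by a part of small measure and a part where the derivative
in the direction `v` is small. -/
lemma measure_range_le_of_cutoff {n m : ℕ} {na : Seminorm ℝ (Euc n)} {nb : Seminorm ℝ (Euc m)}
    {u v : Euc n} (hv : v ≠ 0) (hadd : na (u + v) ≤ 1) (hsub : na (u - v) ≤ 1)
    {l : Euc n →L[ℝ] ℝ} (hl : l u = 1) {e : Euc m} (he : e ≠ 0)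
    (hfar : ∀ x, ‖x‖ ≤ ‖e‖ * nb x) {g : LipAB na nb (cube n)} {K : NNReal} {G : Euc n → Euc m}
    (hG : LipschitzWith K G) (hGg : ∀ x : cube n, G x = g.1 x) {S : Set (Euc n)}
    (hS : S ⊆ interior (cube n)) {ψ : Euc n → ℝ} (hψS : ∀ x ∈ S, ψ x = 1) {η : NNReal}
    (hη : 0 < η) (hη1 : η ≤ 1) {δ : ℝ} (hδ1 : δ ≤ 1)
    (hδη : 2 * δ * ‖e‖ ^ 2 ≤ (η * ‖v‖) ^ 2) :
    (μH[n] : Measure (Euc m)) (Set.range g.1) ≤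
      (K : ℝ≥0∞) ^ n * (μH[n] : Measure (Euc n)) (cube n \ S) +
      (K : ℝ≥0∞) ^ n * (μH[n] : Measure (Euc n))
        {x | δ ≤ -(lineDeriv ℝ (fun x => dualVec e (G x) - l x) x u * ψ x)} +
      ((K + 3 : NNReal) : ℝ≥0∞) ^ n * η * (μH[n] : Measure (Euc n)) (cube n) := by
  set bad := {x | δ ≤ -(lineDeriv ℝ (fun x => dualVec e (G x) - l x) x u * ψ x)}
  set nondiff := {x | DifferentiableAt ℝ G x}ᶜ
  set good := (S \ bad) \ nondiff
  have hv0 : 0 < ‖v‖ := norm_pos_iff.2 hv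
  have himage : ∀ s : Set (Euc n), (μH[n] : Measure (Euc m)) (G '' s) ≤
      (K : ℝ≥0∞) ^ n * (μH[n] : Measure (Euc n)) s := fun s => by
    simpa using hG.hausdorffMeasure_image_le (d := n) n.cast_nonneg s
  have hnondiff : (μH[n] : Measure (Euc m)) (G '' nondiff) = 0 := by
    refine le_antisymm ((himage _).trans_eq ?_) bot_le
    rw [ae_fderiv_of_lipschitz hG, mul_zero]
  have hgood : (μH[n] : Measure (Euc m)) (G '' good) ≤
      ((K + 3 : NNReal) : ℝ≥0∞) ^ n * η * (μH[n] : Measure (Euc n)) (cube n) := by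
    have hsubset : good ⊆ cube n := fun x hx => interior_subset (hS hx.1.1)
    refine (measure_image_le_of_fderiv_small (v := ‖v‖⁻¹ • v) (K := K) ?_ hη hη1
      (fun x hx => not_not.1 hx.2) (fun x _ => norm_fderiv_le_of_lipschitz ℝ hG)
      fun x hx => ?_).trans (by gcongr)
    · rw [norm_smul, norm_inv, norm_norm, inv_mul_cancel₀ hv0.ne']
    · obtain ⟨⟨hxS, hxb⟩, hxd⟩ := hx
      have hxd : DifferentiableAt ℝ G x := not_not.1 hxd
      have hle := seminorm_fderiv_le hGg (hS hxS) hxd.hasFDerivAt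
      have hnorm : ∀ w, na w ≤ 1 → ‖fderiv ℝ G x w‖ ≤ ‖e‖ := fun w hw =>
        (hfar _).trans (mul_le_of_le_one_right (norm_nonneg _) ((hle w).trans hw))
      have hder : (1 - δ) * ‖e‖ ^ 2 ≤ inner ℝ e (fderiv ℝ G x u) := by
        have h1 : -(lineDeriv ℝ (fun x => dualVec e (G x) - l x) x u * ψ x) < δ := not_le.1 hxb
        rw [(hasLineDerivAt_dualVec_comp_sub e l hxd u).lineDeriv, hψS x hxS, hl, mul_one,
          dualVec_apply] at h1
        have h2 : 1 - δ ≤ (‖e‖ ^ 2)⁻¹ * inner ℝ e (fderiv ℝ G x u) := by linarith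
        rwa [inv_mul_eq_div, le_div_iff₀ (pow_pos (norm_pos_iff.2 he) 2)] at h2
      have h3 := norm_sq_le_of_norm_add_sub_le hδ1 he
        (by rw [← map_add]; exact hnorm _ hadd) (by rw [← map_sub]; exact hnorm _ hsub) hder
      have h4 : ‖fderiv ℝ G x v‖ ≤ η * ‖v‖ :=
        le_of_sq_le_sq (h3.trans hδη) (by positivity)
      rw [map_smul, norm_smul, norm_inv, norm_norm, inv_mul_le_iff₀ hv0, mul_comm]
      exact h4
  have hcover : cube n ⊆ ((cube n \ S ∪ bad) ∪ good) ∪ nondiff := fun x hx => by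
    by_cases h1 : x ∈ S <;> by_cases h2 : x ∈ bad <;> by_cases h3 : x ∈ nondiff <;>
      simp [good, h1, h2, h3, hx]
  rw [range_eq_image_cube hGg]
  refine (measure_mono (Set.image_mono hcover)).trans ?_
  rw [Set.image_union, Set.image_union, Set.image_union]
  refine (measure_union_le _ _).trans ?_
  rw [hnondiff, add_zero]
  refine (measure_union_le _ _).trans (add_le_add ((measure_union_le _ _).trans ?_) hgood)
  exact add_le_add (himage _) (himage _)

lemma measure_lineDeriv_le_of_cutoff {n m : ℕ} {na : Seminorm ℝ (Euc n)}
    {nb : Seminorm ℝ (Euc m)} {u : Euc n} (hu : na u = 1) {l : Euc n →L[ℝ] ℝ} (hl : l u = 1)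
    {e : Euc m} (he : e ≠ 0) (hfar : ∀ x, ‖x‖ ≤ ‖e‖ * nb x) {g : LipAB na nb (cube n)}
    {K : NNReal} {G : Euc n → Euc m} (hG : LipschitzWith K G) (hGg : ∀ x : cube n, G x = g.1 x)
    {ε : ℝ} (hgε : ∀ x ∈ cube n, ‖G x - l x • e‖ ≤ ε) {D : NNReal} {ψ : Euc n → ℝ}
    (hψ : LipschitzWith D ψ) (hc : HasCompactSupport ψ) (hψ0 : ∀ x, 0 ≤ ψ x)
    (hψU : tsupport ψ ⊆ interior (cube n)) {δ : ℝ} (hδ : 0 < δ) :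
    (μH[n] : Measure (Euc n))
        {x | δ ≤ -(lineDeriv ℝ (fun x => dualVec e (G x) - l x) x u * ψ x)} ≤
      ENNReal.ofReal
        (D * ‖u‖ * (ε / ‖e‖) * (μH[n] : Measure (Euc n)).real (tsupport ψ) / δ) := by
  set bad := {x | δ ≤ -(lineDeriv ℝ (fun x => dualVec e (G x) - l x) x u * ψ x)}
  have hbad : bad ⊆ tsupport ψ := fun x hx => by
    by_contra hxt
    have h1 : δ ≤ -(lineDeriv ℝ (fun x => dualVec e (G x) - l x) x u * ψ x) := hx
    rw [image_eq_zero_of_notMem_tsupport hxt, mul_zero, neg_zero] at h1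
    exact absurd h1 (not_le.2 hδ)
  have hfin : (μH[n] : Measure (Euc n)) bad ≠ ⊤ :=
    ((measure_mono hbad).trans_lt hc.isCompact.measure_lt_top).ne
  have hb : ∀ x ∈ tsupport ψ, |dualVec e (G x) - l x| ≤ ε / ‖e‖ := fun x hx => by
    have h1 : dualVec e (G x) - l x = dualVec e (G x - l x • e) := by
      rw [map_sub, map_smul, dualVec_self he, smul_eq_mul, mul_one]
    rw [h1]
    exact (abs_dualVec_le he _).trans
      (div_le_div_of_nonneg_right (hgε x (interior_subset (hψU hx))) (norm_nonneg _))
  have hdiff : ∀ᵐ x ∂(μH[n] : Measure (Euc n)), DifferentiableAt ℝ G x :=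
    ae_fderiv_of_lipschitz hG
  have hmono : ∀ᵐ x ∂(μH[n] : Measure (Euc n)), x ∈ tsupport ψ →
      lineDeriv ℝ (fun x => dualVec e (G x) - l x) x u ≤ 0 := by
    filter_upwards [hdiff] with x hxd hxt
    rw [(hasLineDerivAt_dualVec_comp_sub e l hxd u).lineDeriv, hl, sub_nonpos]
    exact (dualVec_le_seminorm he hfar _).trans
      ((seminorm_fderiv_le hGg (hψU hxt) hxd.hasFDerivAt u).trans_eq hu)
  have h := mul_measureReal_lineDeriv_le (((dualVec e).lipschitz.comp hG).sub l.lipschitz)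
    hψ hc hψ0 hb u hmono δ
  rw [← ENNReal.ofReal_toReal hfin]
  refine ENNReal.ofReal_le_ofReal ?_
  rw [le_div_iff₀ hδ, mul_comm]
  exact h

/-- There is an open ball of `1`-Lipschitz maps whose images have small measure. -/
lemma exists_ball_measure_range_le {n m : ℕ} (hm : 0 < m) {na : Seminorm ℝ (Euc n)}
    {nb : Seminorm ℝ (Euc m)} (hnb : ∀ x, nb x = 0 → x = 0) {u v : Euc n} (hu : na u = 1)
    (hv : v ≠ 0) (hadd : na (u + v) ≤ 1) (hsub : na (u - v) ≤ 1) {Δ : ℝ} (hΔ : 0 < Δ) :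
    ∃ (f : LipAB na nb (cube n)) (ε : ℝ), 0 < ε ∧ ∀ g ∈ ball f ε,
      (μH[n] : Measure (Euc m)) (Set.range g.1) ≤ ENNReal.ofReal Δ := by
  obtain ⟨l, hl, hla⟩ := exists_dual_of_seminorm na hu
  obtain ⟨e, he, hbe, hfar⟩ := exists_farthest_point hm nb hnb
  obtain ⟨K, hK⟩ := exists_lipschitz_extension (n := n) hm na nb hnb
  have he0 : 0 < ‖e‖ := norm_pos_iff.2 he
  have hv0 : 0 < ‖v‖ := norm_pos_iff.2 hv
  set τ := ENNReal.ofReal (Δ / 3) with hτ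
  have hτ0 : τ ≠ 0 := by rw [hτ, Ne, ENNReal.ofReal_eq_zero, not_le]; positivity
  have hcube : (μH[n] : Measure (Euc n)) (cube n) ≠ ⊤ := (isCompact_cube n).measure_lt_top.ne
  have hKn : (K : ℝ≥0∞) ^ n ≠ ⊤ := ENNReal.pow_ne_top ENNReal.coe_ne_top
  obtain ⟨η₀, hη₀, hη₀τ⟩ := ENNReal.exists_nnreal_pos_mul_lt (b := τ)
    (ENNReal.mul_ne_top (ENNReal.pow_ne_top (n := n) (ENNReal.coe_ne_top (r := K + 3))) hcube) hτ0
  obtain ⟨θ, hθ, hθτ⟩ := ENNReal.exists_nnreal_pos_mul_lt hKn hτ0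
  set η := min η₀ 1
  have hη : 0 < η := lt_min hη₀ one_pos
  have hη' : (0 : ℝ) < η := hη
  set δ := min 1 ((η * ‖v‖) ^ 2 / (2 * ‖e‖ ^ 2))
  have hδ : 0 < δ := lt_min one_pos (by positivity)
  have hδη : 2 * δ * ‖e‖ ^ 2 ≤ (η * ‖v‖) ^ 2 := by
    have h1 : δ ≤ (η * ‖v‖) ^ 2 / (2 * ‖e‖ ^ 2) := min_le_right _ _
    rw [le_div_iff₀ (by positivity)] at h1
    linarith
  obtain ⟨S, hSc, hSU, hSθ⟩ := exists_compact_subset_interior_cube n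
    (ENNReal.coe_ne_zero.2 hθ.ne')
  obtain ⟨D, ψ, hψ, hψc, hψ0, hψU, hψS⟩ := exists_cutoff_of_isCompact hSc isOpen_interior
    ((isCompact_cube n).isBounded.subset interior_subset) hSU
  set Q := D * ‖u‖ * (μH[n] : Measure (Euc n)).real (tsupport ψ) with hQ
  have hQ0 : 0 ≤ Q := by positivity
  have hθ' : (0 : ℝ) < θ := hθ
  have hf : ∀ x ∈ cube n, ∀ y ∈ cube n, nb (l x • e - l y • e) ≤ na (x - y) := fun x _ y _ => by
    rw [← sub_smul, ← map_sub, map_smul_eq_mul, hbe, mul_one]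
    exact hla _
  refine ⟨lipABMk (fun x => l x • e) (by fun_prop) hf, θ * δ * ‖e‖ / (Q + 1), by positivity,
    fun g hg => ?_⟩
  obtain ⟨G, hGL, hG⟩ := hK g
  have hgε : ∀ x ∈ cube n, ‖G x - l x • e‖ ≤ θ * δ * ‖e‖ / (Q + 1) := fun x hx => by
    rw [hG ⟨x, hx⟩]
    exact (norm_sub_le_dist_lipAB g (lipABMk (fun x => l x • e) (by fun_prop) hf) ⟨x, hx⟩).trans
      (mem_ball.1 hg).le
  have hbad := measure_lineDeriv_le_of_cutoff hu hl he hfar hGL hG hgε hψ hψc hψ0 hψU hδ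
  have hbadθ : D * ‖u‖ * (θ * δ * ‖e‖ / (Q + 1) / ‖e‖) *
      (μH[n] : Measure (Euc n)).real (tsupport ψ) / δ ≤ θ := by
    have h1 : D * ‖u‖ * (θ * δ * ‖e‖ / (Q + 1) / ‖e‖) *
        (μH[n] : Measure (Euc n)).real (tsupport ψ) / δ = θ * (Q / (Q + 1)) := by
      rw [show Q / (Q + 1) = D * ‖u‖ * (μH[n] : Measure (Euc n)).real (tsupport ψ) / (Q + 1) by
        rw [← hQ]]
      field_simp
    rw [h1]
    exact mul_le_of_le_one_right hθ'.le ((div_le_one (by positivity)).2 (by linarith))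
  have hmain := measure_range_le_of_cutoff hv hadd hsub hl he hfar hGL hG hSU hψS hη
    (min_le_right _ _) (min_le_left _ _) hδη
  refine hmain.trans ?_
  have hsum : ENNReal.ofReal Δ = τ + τ + τ := by
    rw [hτ, ← ENNReal.ofReal_add (by positivity) (by positivity),
      ← ENNReal.ofReal_add (by positivity) (by positivity)]
    congr 1
    ring
  rw [hsum]
  rw [mul_comm] at hθτ
  refine add_le_add (add_le_add ?_ ?_) ?_
  · exact (mul_le_mul_right hSθ _).trans hθτ.le
  · refine (mul_le_mul_right (hbad.trans (ENNReal.ofReal_le_ofReal hbadθ)) _).trans ?_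
    rw [ENNReal.ofReal_coe_nnreal]
    exact hθτ.le
  · refine le_trans (le_of_eq_of_le (by ring) (mul_le_mul_left (ENNReal.coe_le_coe.2
      (min_le_left η₀ 1)) (((K + 3 : NNReal) : ℝ≥0∞) ^ n * μH[n] (cube n)))) hη₀τ.le

/-- Let `|·|_a` be a norm on `ℝ^n` whose unit sphere contains a non-extremal
point of its unit ball, `|·|_b` any norm on `ℝ^m` (`n ≤ m`), and `X = ([-1,1]^n, |·|_a)`.
For every `Δ ≥ 0`, the set `{f ∈ Lip_1(X, ℝ^m_b) : H^n(f(X)) > Δ}` is residual in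
`Lip_1(X, ℝ^m_b)` if and only if `Δ = 0`. -/
theorem stmt2 (n m : ℕ) (hnm : n ≤ m)
    (na : Seminorm ℝ (Euc n)) (hna : ∀ x, na x = 0 → x = 0)
    (nb : Seminorm ℝ (Euc m)) (hnb : ∀ x, nb x = 0 → x = 0)
    (hu : ∃ u : Euc n, na u = 1 ∧ ¬ IsExtremalPt {x | na x ≤ 1} u)
    (Δ : ℝ) (hΔ : 0 ≤ Δ) :
    ({f : LipAB na nb (cube n) | ENNReal.ofReal Δ < μH[n] (Set.range ⇑f.1)}
        ∈ residual (LipAB na nb (cube n))) ↔ Δ = 0 := by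
  obtain ⟨u, hu1, hext⟩ := hu
  have hn : 0 < n := by
    rcases Nat.eq_zero_or_pos n with rfl | h
    · rw [Subsingleton.elim u 0, map_zero] at hu1
      exact absurd hu1 zero_ne_one
    · exact h
  constructor
  · intro hres
    by_contra hΔ0
    simp only [IsExtremalPt, not_forall] at hext
    obtain ⟨v, hadd, hsub, hv⟩ := hext
    obtain ⟨f, ε, hε, hball⟩ := exists_ball_measure_range_le (hn.trans_le hnm) hnb hu1 hv hadd hsub
      (hΔ.lt_of_ne (Ne.symm hΔ0))
    have := completeSpace_lipAB na nb (cube n)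
    obtain ⟨g, hg, hgΔ⟩ := Metric.dense_iff.1 (dense_of_mem_residual hres) f ε hε
    exact absurd (hball g hg) (not_le.2 hgΔ)
  · rintro rfl
    rw [ENNReal.ofReal_zero]
    exact residual_measure_range_pos hn hnm hna hnb
end
end

section
/- Let n, m be natural numbers with n ≤ m, let |·|_a be a norm on ℝ^n whose unit sphere ∂B_a contains a point that is not an extremal point of the unit ball B_a, let |·|_b be an arbitrary norm on ℝ^m, and let Ω ⊂ ℝ^n be open and bounded. Then for every Δ ≥ 0 each of the sets {f ∈ Lip_1(Ω_a, ℝ^m_b) : ∫_Ω vol f'(x) dH^n(x) ≥ Δ} (where f'(x) denotes the Fréchet derivative of f, which exists at H^n-almost every x ∈ Ω by Rademacher's theorem) and {f ∈ Lip_1(Ω_a, ℝ^m_b) : H^n(f(Ω)) ≥ Δ} is dense in Lip_1(Ω_a, ℝ^m_b) if and only if Δ = 0. -/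
open MeasureTheory Metric Set Filter Topology ENNReal

noncomputable section

/-- The matrix of a continuous linear map between Euclidean spaces. -/
def matrixOf {n m : ℕ} (A : Euc n →L[ℝ] Euc m) : Matrix (Fin m) (Fin n) ℝ :=
  Matrix.of fun i j => A (EuclideanSpace.single j 1) i

/-- `vol A = sqrt (det (Aᵀ A))`. -/
def volMap {n m : ℕ} (A : Euc n →L[ℝ] Euc m) : ℝ :=
  Real.sqrt ((Matrix.transpose (matrixOf A) * matrixOf A).det)

/-- The extension by zero of a function defined on a subset `D ⊆ ℝ^n`. -/
def extZero {n m : ℕ} {D : Set (Euc n)} (f : ↥D → Euc m) : Euc n → Euc m :=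
  Function.extend (Subtype.val : ↥D → Euc n) f fun _ => 0

open scoped NNReal RealInnerProductSpace

section Cutoff

variable {E : Type*} [NormedAddCommGroup E] [NormedSpace ℝ E] [FiniteDimensional ℝ E]
  [MeasurableSpace E] [BorelSpace E] (μ : Measure E) [μ.IsAddHaarMeasure]

/-- A bounded open set carries Lipschitz cutoff functions which are equal to `1` outside a set of
small measure. -/
theorem exists_lipschitz_cutoff {Ω : Set E} (hΩ : IsOpen Ω) (hb : Bornology.IsBounded Ω)
    (hne : Ωᶜ.Nonempty) {ε : ℝ≥0∞} (hε : 0 < ε) :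
    ∃ (C : ℝ≥0) (φ : E → ℝ), LipschitzWith C φ ∧ (∀ x, 0 ≤ φ x) ∧
      (∀ x ∉ Ω, φ x = 0) ∧ μ {x ∈ Ω | φ x ≠ 1} < ε := by
  let φ : ℕ → E → ℝ := fun k x => min ((k : ℝ) * infDist x Ωᶜ) 1
  have hlip : ∀ k : ℕ, LipschitzWith (k : ℝ≥0) (φ k) := fun k => by
    have := (LipschitzWith.of_dist_le_mul (K := (k : ℝ≥0))
      (f := fun x => (k : ℝ) * infDist x Ωᶜ) (fun x y => by
        rw [Real.dist_eq, ← mul_sub, abs_mul, Nat.abs_cast, ← Real.dist_eq]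
        have := (lipschitz_infDist_pt Ωᶜ).dist_le_mul x y
        simp only [NNReal.coe_one, one_mul] at this
        simpa using mul_le_mul_of_nonneg_left this (Nat.cast_nonneg k)))
    exact this.min_const 1
  have hmeas : ∀ k, MeasurableSet {x ∈ Ω | φ k x ≠ 1} := fun k =>
    hΩ.measurableSet.inter
      ((measurableSet_singleton (1 : ℝ)).compl.preimage (hlip k).continuous.measurable)
  have hanti : Antitone fun k => {x ∈ Ω | φ k x ≠ 1} := by
    rintro j k hjk x ⟨hx, h⟩
    refine ⟨hx, fun hj => h ?_⟩
    have h1 : 1 ≤ (j : ℝ) * infDist x Ωᶜ := min_eq_right_iff.1 hj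
    have h2 : (j : ℝ) * infDist x Ωᶜ ≤ k * infDist x Ωᶜ :=
      mul_le_mul_of_nonneg_right (by exact_mod_cast hjk) infDist_nonneg
    exact min_eq_right (h1.trans h2)
  have hlim := tendsto_measure_iInter_atTop (μ := μ) (fun k => (hmeas k).nullMeasurableSet) hanti
    ⟨0, ((measure_mono (sep_subset _ _)).trans_lt hb.measure_lt_top).ne⟩
  have hempty : ⋂ k, {x ∈ Ω | φ k x ≠ 1} = ∅ := by
    refine eq_empty_of_forall_notMem fun x hx => ?_
    have hx' := mem_iInter.1 hx
    have hpos : 0 < infDist x Ωᶜ :=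
      (hΩ.isClosed_compl.notMem_iff_infDist_pos hne).1 (fun h => h (hx' 0).1)
    obtain ⟨k, hk⟩ := exists_nat_ge (1 / infDist x Ωᶜ)
    exact (hx' k).2 (min_eq_right ((div_le_iff₀ hpos).1 hk))
  rw [hempty, measure_empty] at hlim
  obtain ⟨k, hk⟩ := (hlim.eventually (gt_mem_nhds hε)).exists
  refine ⟨k, φ k, hlip k,
    fun x => le_min (mul_nonneg (Nat.cast_nonneg k) infDist_nonneg) zero_le_one,
    fun x hx => ?_, hk⟩
  simp [φ, infDist_zero_of_mem (show x ∈ Ωᶜ from hx)]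

/-- If a Lipschitz function is monotone in direction `u` on a bounded open set and is uniformly
small there, then its derivative in direction `u` is small outside a set of small measure. -/
theorem exists_measure_le_lineDeriv_lt {Ω : Set E} (hΩ : IsOpen Ω) (hb : Bornology.IsBounded Ω)
    (hne : Ωᶜ.Nonempty) (u : E) {ε : ℝ≥0∞} (hε : 0 < ε) {t : ℝ} (ht : 0 < t) :
    ∃ δ > 0, ∀ (C : ℝ≥0) (h : E → ℝ), LipschitzWith C h →
      (∀ᵐ x ∂μ, x ∈ Ω → 0 ≤ lineDeriv ℝ h x u) → (∀ x ∈ Ω, |h x| ≤ δ) →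
      μ {x ∈ Ω | t ≤ lineDeriv ℝ h x u} < ε := by
  obtain ⟨ε', hε', hεε⟩ := exists_between hε
  obtain ⟨K, φ, hφ, hφ0, hφΩ, hφε⟩ := exists_lipschitz_cutoff μ hΩ hb hne hε'
  obtain ⟨r, hr, hrε⟩ : ∃ r : ℝ, 0 < r ∧ ε' + ENNReal.ofReal r < ε := by
    have : Tendsto (fun r : ℝ => ε' + ENNReal.ofReal r) (𝓝[>] 0) (𝓝 (ε' + ENNReal.ofReal 0)) :=
      ((ENNReal.continuous_ofReal.tendsto 0).const_add ε').mono_left nhdsWithin_le_nhds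
    rw [ENNReal.ofReal_zero, add_zero] at this
    obtain ⟨r, h1, h2⟩ := ((this.eventually (gt_mem_nhds hεε)).and self_mem_nhdsWithin).exists
    exact ⟨r, h2, h1⟩
  set M : ℝ := K * ‖u‖ * μ.real Ω
  have hM : 0 ≤ M := by positivity
  refine ⟨t * r / (M + 1), by positivity, fun C h hh hmono hsmall => ?_⟩
  have hcs : HasCompactSupport φ := HasCompactSupport.of_support_subset_isCompact
    hb.isCompact_closure fun x hx => subset_closure (by_contra fun hx' => hx (hφΩ x hx'))
  have hint : Integrable (fun x => lineDeriv ℝ h x u * φ x) μ :=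
    (hφ.continuous.integrable_of_hasCompactSupport hcs).bdd_mul
      (measurable_lineDeriv hh.continuous).aestronglyMeasurable
      (Eventually.of_forall fun x => norm_lineDeriv_le_of_lipschitz ℝ hh)
  have hnn : 0 ≤ᵐ[μ] fun x => lineDeriv ℝ h x u * φ x := by
    filter_upwards [hmono] with x hx
    by_cases hxΩ : x ∈ Ω
    · exact mul_nonneg (hx hxΩ) (hφ0 x)
    · simp [hφΩ x hxΩ]
  have hle : ∫ x, lineDeriv ℝ h x u * φ x ∂μ ≤ t * r := by
    rw [hh.integral_lineDeriv_mul_eq hφ hcs u]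
    have hzero : ∀ x ∉ Ω, lineDeriv ℝ φ x (-u) * h x = 0 := fun x hx => by
      have : IsLocalMin (fun s : ℝ => φ (x + s • -u)) 0 :=
        Eventually.of_forall fun s => by simpa [hφΩ x hx] using hφ0 _
      rw [lineDeriv, this.deriv_eq_zero, zero_mul]
    rw [← setIntegral_eq_integral_of_forall_compl_eq_zero hzero]
    have := norm_setIntegral_le_of_norm_le_const (μ := μ) (s := Ω)
      (f := fun x => lineDeriv ℝ φ x (-u) * h x) (C := K * ‖u‖ * (t * r / (M + 1)))
      hb.measure_lt_top (fun x hx => by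
        rw [norm_mul]
        have h1 := norm_lineDeriv_le_of_lipschitz ℝ hφ (x₀ := x) (v := -u)
        rw [norm_neg] at h1
        exact mul_le_mul h1 (hsmall x hx) (norm_nonneg _) (by positivity))
    refine (le_abs_self _).trans (this.trans ?_)
    calc K * ‖u‖ * (t * r / (M + 1)) * μ.real Ω = (t * r) * (M / (M + 1)) := by
          simp only [M]; ring
      _ ≤ t * r * 1 := by
          gcongr
          rw [div_le_one (by positivity)]
          linarith
      _ = t * r := mul_one _
  have hmarkov := (mul_meas_ge_le_integral_of_nonneg hnn hint t).trans hle
  have hfin : μ {x | t ≤ lineDeriv ℝ h x u * φ x} ≠ ∞ := by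
    refine ((measure_mono fun x hx => ?_).trans_lt hb.measure_lt_top).ne
    by_contra hxΩ
    have : t ≤ lineDeriv ℝ h x u * φ x := hx
    rw [hφΩ x hxΩ, mul_zero] at this
    exact ht.not_ge this
  have hmarkov' : μ {x | t ≤ lineDeriv ℝ h x u * φ x} ≤ ENNReal.ofReal r :=
    (ENNReal.le_ofReal_iff_toReal_le hfin hr.le).2 (le_of_mul_le_mul_left hmarkov ht)
  calc μ {x ∈ Ω | t ≤ lineDeriv ℝ h x u}
      ≤ μ ({x ∈ Ω | φ x ≠ 1} ∪ {x | t ≤ lineDeriv ℝ h x u * φ x}) := by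
        refine measure_mono fun x hx => ?_
        by_cases h1 : φ x = 1
        · exact Or.inr (by simpa [h1] using hx.2)
        · exact Or.inl ⟨hx.1, h1⟩
    _ ≤ ε' + ENNReal.ofReal r := (measure_union_le _ _).trans (add_le_add hφε.le hmarkov')
    _ < ε := hrε

end Cutoff

section Volume

variable {n m : ℕ}

theorem continuous_volMap : Continuous (volMap : (Euc n →L[ℝ] Euc m) → ℝ) := by
  have h : Continuous (matrixOf : (Euc n →L[ℝ] Euc m) → _) := by
    refine continuous_pi fun i => continuous_pi fun j => ?_
    have h1 : Continuous fun A : Euc n →L[ℝ] Euc m => A (EuclideanSpace.single j 1) :=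
      continuous_eval_const _
    exact (EuclideanSpace.proj (𝕜 := ℝ) i).continuous.comp h1
  exact Real.continuous_sqrt.comp ((h.matrix_transpose.matrix_mul h).matrix_det)

theorem matrixOf_mulVec (A : Euc n →L[ℝ] Euc m) (v : Euc n) (i : Fin m) :
    (matrixOf A).mulVec v i = A v i := by
  have hv : v = ∑ j, v j • EuclideanSpace.single j (1 : ℝ) := by
    ext k
    simp [Pi.single_apply]
  conv_rhs => rw [hv]
  simp [Matrix.mulVec, dotProduct, matrixOf, map_sum, mul_comm]

theorem volMap_eq_zero {A : Euc n →L[ℝ] Euc m} {v : Euc n} (hv : v ≠ 0) (h : A v = 0) :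
    volMap A = 0 := by
  have h1 : (matrixOf A).mulVec v = 0 := by
    ext i
    simp [matrixOf_mulVec, h]
  have h2 : ((Matrix.transpose (matrixOf A) * matrixOf A).det) = 0 := by
    refine Matrix.exists_mulVec_eq_zero_iff.1 ⟨v, fun h0 => hv ?_, ?_⟩
    · ext i
      exact congrFun h0 i
    · rw [← Matrix.mulVec_mulVec, h1, Matrix.mulVec_zero]
  rw [volMap, h2, Real.sqrt_zero]

theorem exists_volMap_le (K : ℝ) :
    ∃ M : ℝ, ∀ A : Euc n →L[ℝ] Euc m, ‖A‖ ≤ K → volMap A ≤ M := by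
  obtain ⟨M, hM⟩ := (isCompact_closedBall (0 : Euc n →L[ℝ] Euc m) K).bddAbove_image
    continuous_volMap.continuousOn
  exact ⟨M, fun A hA => hM (mem_image_of_mem _ (mem_closedBall_zero_iff.2 hA))⟩

/-- Linear maps of bounded norm which almost kill a fixed nonzero vector have small volume. -/
theorem exists_volMap_lt (K : ℝ) {v : Euc n} (hv : v ≠ 0) {ε : ℝ} (hε : 0 < ε) :
    ∃ η > 0, ∀ A : Euc n →L[ℝ] Euc m, ‖A‖ ≤ K → ‖A v‖ < η → volMap A < ε := by
  set S : Set (Euc n →L[ℝ] Euc m) := closedBall 0 K ∩ {A | ε ≤ volMap A}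
  have hS : IsCompact S := (isCompact_closedBall _ _).inter_right
    (isClosed_le continuous_const continuous_volMap)
  have hc : ContinuousOn (fun A : Euc n →L[ℝ] Euc m => ‖A v‖) S :=
    (continuous_eval_const v).norm.continuousOn
  rcases S.eq_empty_or_nonempty with h0 | hne
  · refine ⟨1, one_pos, fun A hA _ => ?_⟩
    by_contra! h
    exact (h0.subset ⟨mem_closedBall_zero_iff.2 hA, h⟩ : A ∈ (∅ : Set _))
  · obtain ⟨B, hB, hmin⟩ := hS.exists_isMinOn hne hc
    refine ⟨‖B v‖, norm_pos_iff.2 fun h => ?_, fun A hA hlt => ?_⟩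
    · have : ε ≤ volMap B := hB.2
      rw [volMap_eq_zero hv h] at this
      exact hε.not_ge this
    · by_contra! h
      exact hlt.not_ge (hmin ⟨mem_closedBall_zero_iff.2 hA, h⟩)

end Volume

section Squeeze

variable {E : Type*} [NormedAddCommGroup E] [InnerProductSpace ℝ E]

/-- The linear map shrinking the direction of `v` by the factor `η` and multiplying the orthogonal
complement of `v` by `1 + η`. -/
def squeeze (v : E) (η : ℝ) : E →L[ℝ] E :=
  (ContinuousLinearMap.id ℝ E - ((‖v‖ ^ 2)⁻¹ • (innerSL ℝ v).smulRight v)) +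
    η • ContinuousLinearMap.id ℝ E

theorem squeeze_apply (v : E) (η : ℝ) (z : E) :
    squeeze v η z = (z - ((‖v‖ ^ 2)⁻¹ * ⟪v, z⟫) • v) + η • z := by
  simp [squeeze, smul_smul]

theorem exists_det_squeeze_lt [FiniteDimensional ℝ E] {v : E} (hv : v ≠ 0) {ε : ℝ} (hε : 0 < ε) :
    ∃ η > 0, |LinearMap.det (squeeze v η : E →ₗ[ℝ] E)| < ε := by
  have h0 : LinearMap.det (squeeze v 0 : E →ₗ[ℝ] E) = 0 := by
    by_contra h
    apply hv
    have : (LinearMap.equivOfDetNeZero _ h) v = 0 := by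
      change squeeze v 0 v = 0
      rw [squeeze_apply, real_inner_self_eq_norm_sq, inv_mul_cancel₀ (by simpa using hv)]
      simp
    exact (LinearEquiv.map_eq_zero_iff _).1 this
  have hc : Continuous fun η : ℝ => |(squeeze v η).det| := by
    have h1 : Continuous fun η : ℝ => squeeze v η := by
      unfold squeeze
      fun_prop
    exact (ContinuousLinearMap.continuous_det.comp h1).abs
  have hlim : Tendsto (fun η : ℝ => |(squeeze v η).det|) (𝓝[>] 0) (𝓝 |(squeeze v 0).det|) :=
    (hc.tendsto 0).mono_left nhdsWithin_le_nhds
  have hz : |(squeeze v 0).det| = 0 := by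
    rw [abs_eq_zero]; exact h0
  rw [hz] at hlim
  obtain ⟨η, h1, h2⟩ := ((hlim.eventually (gt_mem_nhds hε)).and self_mem_nhdsWithin).exists
  exact ⟨η, h2, h1⟩

theorem norm_sub_le_norm_squeeze (v : E) {η : ℝ} (hη : 0 ≤ η) (z : E) :
    ‖z - ((‖v‖ ^ 2)⁻¹ * ⟪v, z⟫) • v‖ ≤ ‖squeeze v η z‖ ∧ η * ‖z‖ ≤ ‖squeeze v η z‖ := by
  set p := z - ((‖v‖ ^ 2)⁻¹ * ⟪v, z⟫) • v with hp
  have hin : 0 ≤ ⟪p, z⟫ := by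
    rw [hp, inner_sub_left, real_inner_smul_left, real_inner_self_eq_norm_sq, sub_nonneg]
    rcases eq_or_ne v 0 with rfl | hv
    · simp
    · have h1 : 0 < ‖v‖ ^ 2 := by positivity
      rw [mul_assoc, inv_mul_le_iff₀ h1, ← mul_pow, ← sq, ← sq_abs]
      exact pow_le_pow_left₀ (abs_nonneg _) (abs_real_inner_le_norm v z) 2
  have hsq : ‖squeeze v η z‖ ^ 2 = ‖p‖ ^ 2 + 2 * (η * ⟪p, z⟫) + (η * ‖z‖) ^ 2 := by
    rw [squeeze_apply, ← hp, norm_add_sq_real, real_inner_smul_right, norm_smul,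
      Real.norm_of_nonneg hη]
  have h2 : 0 ≤ η * ⟪p, z⟫ := mul_nonneg hη hin
  constructor
  · exact abs_le_of_sq_le_sq' (by nlinarith [sq_nonneg (η * ‖z‖)]) (norm_nonneg _) |>.2
  · exact abs_le_of_sq_le_sq' (by nlinarith [sq_nonneg ‖p‖]) (norm_nonneg _) |>.2

variable {F : Type*} [NormedAddCommGroup F] [NormedSpace ℝ F]

theorem norm_map_add_le_squeeze {v : E} (hv : v ≠ 0) {η K : ℝ} (hη : 0 ≤ η) (A : E →L[ℝ] F)
    (hA : ‖A‖ ≤ K) (hAv : ‖A v‖ ≤ η * ‖v‖) (z : E) :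
    ‖A z‖ + η * ‖z‖ ≤ (K + 2) * ‖squeeze v η z‖ := by
  obtain ⟨h1, h2⟩ := norm_sub_le_norm_squeeze v hη z
  set c := (‖v‖ ^ 2)⁻¹ * ⟪v, z⟫ with hc
  have hv' : 0 < ‖v‖ := norm_pos_iff.2 hv
  have hcz : |c| * ‖v‖ ≤ ‖z‖ := by
    rw [hc, abs_mul, abs_of_nonneg (by positivity), mul_assoc, inv_mul_le_iff₀ (by positivity)]
    nlinarith [abs_real_inner_le_norm v z]
  have hK : 0 ≤ K := (norm_nonneg A).trans hA
  have hz : A z = A (z - c • v) + c • A v := by simp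
  calc ‖A z‖ + η * ‖z‖ ≤ (‖A (z - c • v)‖ + |c| * ‖A v‖) + η * ‖z‖ := by
        rw [hz]
        gcongr
        exact (norm_add_le _ _).trans_eq (by rw [norm_smul, Real.norm_eq_abs])
    _ ≤ (K * ‖z - c • v‖ + η * ‖z‖) + η * ‖z‖ := by
        have hp := A.le_of_opNorm_le hA (z - c • v)
        suffices |c| * ‖A v‖ ≤ η * ‖z‖ by linarith
        calc |c| * ‖A v‖ ≤ |c| * (η * ‖v‖) := by gcongr
          _ = η * (|c| * ‖v‖) := by ring
          _ ≤ η * ‖z‖ := by gcongr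
    _ ≤ (K + 2) * ‖squeeze v η z‖ := by
        nlinarith [mul_le_mul_of_nonneg_left h1 hK]

end Squeeze

section Hausdorff

variable {n m : ℕ}

instance isAddHaarMeasure_hausdorffMeasure_euc : (μH[n] : Measure (Euc n)).IsAddHaarMeasure := by
  simpa using isAddHaarMeasure_hausdorffMeasure (E := Euc n)

/-- A Lipschitz map whose derivative almost kills a fixed nonzero vector has an image of small
`n`-dimensional Hausdorff measure. -/
theorem exists_hausdorffMeasure_image_le (K : ℝ≥0) {v : Euc n} (hv : v ≠ 0) {ε : ℝ} (hε : 0 < ε) :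
    ∃ η > 0, ∀ (G : Euc n → Euc m) (s : Set (Euc n)), LipschitzWith K G →
      (∀ x ∈ s, DifferentiableAt ℝ G x ∧ ‖fderiv ℝ G x v‖ < η) →
      μH[n] (G '' s) ≤ ENNReal.ofReal ε * (μH[n] : Measure (Euc n)) s := by
  obtain ⟨η, hη, hdet⟩ := exists_det_squeeze_lt hv
    (show 0 < ε / ((K + 2 : ℝ≥0) : ℝ) ^ n by positivity)
  have hv' : 0 < ‖v‖ := norm_pos_iff.2 hv
  refine ⟨η * ‖v‖, by positivity, fun G s hG hs => ?_⟩
  obtain ⟨t, A, htd, htm, hst, hap, hA⟩ :=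
    exists_partition_approximatesLinearOn_of_hasFDerivWithinAt G s (fderiv ℝ G)
      (fun x hx => (hs x hx).1.hasFDerivAt.hasFDerivWithinAt) (fun _ => ⟨η, hη.le⟩)
      (fun _ h => hη.ne' (congrArg NNReal.toReal h))
  rcases s.eq_empty_or_nonempty with rfl | hne
  · simp
  have hL : Function.Injective (squeeze v η) := by
    rw [injective_iff_map_eq_zero]
    intro z hz
    have := (norm_sub_le_norm_squeeze v hη.le z).2
    rw [hz, norm_zero] at this
    exact norm_eq_zero.1 (le_antisymm (nonpos_of_mul_nonpos_right this hη) (norm_nonneg z))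
  have hpiece : ∀ k, μH[n] (G '' (s ∩ t k)) ≤
      ENNReal.ofReal ε * (μH[n] : Measure (Euc n)) (s ∩ t k) := by
    intro k
    obtain ⟨y, hy, hAy⟩ := hA hne k
    have hlip : LipschitzOnWith (K + 2) (G ∘ Function.invFun (squeeze v η))
        (squeeze v η '' (s ∩ t k)) := by
      refine LipschitzOnWith.of_dist_le_mul ?_
      rintro _ ⟨x, hx, rfl⟩ _ ⟨z, hz, rfl⟩
      simp only [Function.comp_apply, Function.leftInverse_invFun hL _]
      rw [dist_eq_norm, dist_eq_norm, ← map_sub]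
      have h1 := hap k x hx z hz
      have h2 := norm_map_add_le_squeeze hv hη.le (A k)
        (hAy ▸ norm_fderiv_le_of_lipschitz ℝ hG) (hAy ▸ (hs y hy).2.le) (x - z)
      calc ‖G x - G z‖ = ‖A k (x - z) + (G x - G z - A k (x - z))‖ := by congr 1; abel
        _ ≤ ‖A k (x - z)‖ + η * ‖x - z‖ := (norm_add_le _ _).trans (add_le_add_right h1 _)
        _ ≤ _ := h2
    have himg : G '' (s ∩ t k) =
        (G ∘ Function.invFun (squeeze v η)) '' (squeeze v η '' (s ∩ t k)) := by
      rw [image_image]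
      exact image_congr fun x _ => by simp [Function.leftInverse_invFun hL x]
    rw [himg]
    refine (hlip.hausdorffMeasure_image_le (Nat.cast_nonneg n)).trans ?_
    have hdm := Measure.addHaar_image_continuousLinearMap (μH[n] : Measure (Euc n))
      (squeeze v η) (s ∩ t k)
    rw [hdm, ← mul_assoc]
    gcongr
    rw [ENNReal.rpow_natCast, ← ENNReal.ofReal_coe_nnreal, ← ENNReal.ofReal_pow (by positivity),
      ← ENNReal.ofReal_mul (by positivity)]
    refine ENNReal.ofReal_le_ofReal ?_
    rw [mul_comm]
    exact ((lt_div_iff₀ (by positivity)).1 hdet).le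
  calc μH[n] (G '' s) ≤ μH[n] (⋃ k, G '' (s ∩ t k)) := by
        refine measure_mono ?_
        rw [← image_iUnion, ← inter_iUnion, inter_eq_self_of_subset_left hst]
    _ ≤ ∑' k, μH[n] (G '' (s ∩ t k)) := measure_iUnion_le _
    _ ≤ ∑' k, ENNReal.ofReal ε * (μH[n] : Measure (Euc n)).restrict s (t k) := by
        refine ENNReal.tsum_le_tsum fun k => (hpiece k).trans_eq ?_
        rw [Measure.restrict_apply (htm k), inter_comm]
    _ = ENNReal.ofReal ε * (μH[n] : Measure (Euc n)).restrict s (⋃ k, t k) := by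
        rw [ENNReal.tsum_mul_left, measure_iUnion htd htm]
    _ ≤ ENNReal.ofReal ε * (μH[n] : Measure (Euc n)) s := by
        exact mul_le_mul' le_rfl
          ((measure_mono (subset_univ _)).trans_eq (Measure.restrict_apply_univ s))

end Hausdorff

section Seminorm

variable {E F : Type*} [NormedAddCommGroup E] [NormedSpace ℝ E] [NormedAddCommGroup F]
  [NormedSpace ℝ F] [FiniteDimensional ℝ F]

theorem Seminorm.continuous_of_finiteDimensional (p : Seminorm ℝ F) : Continuous p :=
  p.convexOn.locallyLipschitz.continuous

theorem seminorm_fderiv_le_s3 {p : Seminorm ℝ E} {q : Seminorm ℝ F} {G : E → F} {s : Set E}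
    (hG : ∀ x ∈ s, ∀ y ∈ s, q (G x - G y) ≤ p (x - y)) {x : E} (hs : s ∈ 𝓝 x)
    (hx : DifferentiableAt ℝ G x) (w : E) : q (fderiv ℝ G x w) ≤ p w := by
  have hlim := (q.continuous_of_finiteDimensional.tendsto _).comp
    (hx.hasFDerivAt.hasLineDerivAt w).tendsto_slope_zero
  refine le_of_tendsto hlim ?_
  have hc : Tendsto (fun t : ℝ => x + t • w) (𝓝[≠] 0) (𝓝 x) := by
    have : Continuous fun t : ℝ => x + t • w := by fun_prop
    simpa using (this.tendsto 0).mono_left nhdsWithin_le_nhds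
  filter_upwards [hc.eventually hs, self_mem_nhdsWithin] with t ht ht0
  have h1 := hG _ ht x (mem_of_mem_nhds hs)
  have ht' : 0 < |t| := abs_pos.2 ht0
  rw [add_sub_cancel_left, map_smul_eq_mul, Real.norm_eq_abs] at h1
  rw [Function.comp_apply, map_smul_eq_mul, norm_inv, Real.norm_eq_abs, inv_mul_le_iff₀ ht']
  exact h1

variable [FiniteDimensional ℝ E]

theorem Seminorm.exists_norm_le_mul (p : Seminorm ℝ E) (hp : ∀ x, p x = 0 → x = 0) :
    ∃ C : ℝ, 0 < C ∧ ∀ x, ‖x‖ ≤ C * p x := by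
  rcases (sphere (0 : E) 1).eq_empty_or_nonempty with h0 | hne
  · refine ⟨1, one_pos, fun x => ?_⟩
    by_cases hx : x = 0
    · simp [hx]
    · exact absurd (h0.subset (show ‖x‖⁻¹ • x ∈ sphere (0 : E) 1 by simp [norm_smul, hx]))
        (notMem_empty _)
  · obtain ⟨y, hy, hmin⟩ := (isCompact_sphere (0 : E) 1).exists_isMinOn hne
      p.continuous_of_finiteDimensional.continuousOn
    have hpy : 0 < p y := lt_of_le_of_ne (apply_nonneg p y) fun h => by
      have := hp y h.symm
      simp [this] at hy
    refine ⟨(p y)⁻¹, inv_pos.2 hpy, fun x => ?_⟩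
    by_cases hx : x = 0
    · simp [hx]
    · have hx' : 0 < ‖x‖ := norm_pos_iff.2 hx
      have h1 : p y ≤ p (‖x‖⁻¹ • x) :=
        hmin (show ‖x‖⁻¹ • x ∈ sphere (0 : E) 1 by simp [norm_smul, hx])
      rw [map_smul_eq_mul, norm_inv, norm_norm, le_inv_mul_iff₀ hx'] at h1
      rwa [le_inv_mul_iff₀ hpy, mul_comm]

/-- Every vector on the unit sphere of a seminorm is normed by a linear functional. -/
theorem Seminorm.exists_linearMap_eq_one (p : Seminorm ℝ E) {u : E} (hu : p u = 1) :
    ∃ l : E →L[ℝ] ℝ, l u = 1 ∧ ∀ x, |l x| ≤ p x := by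
  have hu0 : u ≠ 0 := fun h => by simp [h] at hu
  let f := LinearPMap.mkSpanSingleton (σ := RingHom.id ℝ) u (1 : ℝ) hu0
  obtain ⟨g, hg, hle⟩ := Module.Dual.exists_extension_of_le_seminorm_real f.domain f.toFun
    (p := p) (by
      rintro ⟨x, hx⟩
      obtain ⟨c, rfl⟩ := Submodule.mem_span_singleton.1 hx
      refine (LinearPMap.mkSpanSingleton'_apply _ _ _ c hx).trans_le ?_
      simpa [map_smul_eq_mul, hu] using le_abs_self c)
  exact ⟨LinearMap.toContinuousLinearMap g,
    (hg ⟨u, Submodule.mem_span_singleton_self u⟩).trans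
      (LinearPMap.mkSpanSingleton_apply ℝ ℝ hu0 1), hle⟩

end Seminorm

section Rigidity

variable {E : Type*} [NormedAddCommGroup E] [NormedSpace ℝ E]
  {F : Type*} [NormedAddCommGroup F] [InnerProductSpace ℝ F]

/-- If `A` maps `u + v` and `u - v` into the ball of radius `‖e‖` and `A u` is almost `e`,
then `A v` is small. -/
theorem norm_sq_le_of_norm_le (A : E →L[ℝ] F) {e : F} {u v : E} (h₁ : ‖A (u + v)‖ ≤ ‖e‖)
    (h₂ : ‖A (u - v)‖ ≤ ‖e‖) : ‖A v‖ ^ 2 ≤ 2 * (‖e‖ ^ 2 - ⟪e, A u⟫) := by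
  rw [map_add] at h₁
  rw [map_sub] at h₂
  have e1 := norm_add_sq_real (A u) (A v)
  have e2 := norm_sub_sq_real (A u) (A v)
  have e3 := norm_sub_sq_real e (A u)
  have h1 := pow_le_pow_left₀ (norm_nonneg _) h₁ 2
  have h2 := pow_le_pow_left₀ (norm_nonneg _) h₂ 2
  nlinarith [sq_nonneg ‖e - A u‖]

theorem inner_le_of_norm_le (A : E →L[ℝ] F) {e : F} {u v : E} (h₁ : ‖A (u + v)‖ ≤ ‖e‖)
    (h₂ : ‖A (u - v)‖ ≤ ‖e‖) : 0 ≤ ‖e‖ ^ 2 - ⟪e, A u⟫ := by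
  nlinarith [norm_sq_le_of_norm_le A h₁ h₂, sq_nonneg ‖A v‖]

variable [FiniteDimensional ℝ E] [FiniteDimensional ℝ F] [MeasurableSpace E] [BorelSpace E]
  (μ : Measure E) [μ.IsAddHaarMeasure]

/-- Let `u ± v` lie in the unit ball of `p`, and let `e` be a point of the unit ball of `q` with
maximal Euclidean norm. Every map `G` that is `1`-Lipschitz from `p` to `q` and uniformly close to
`x ↦ l x • e`, where `l u = 1`, has a derivative that almost kills `v` outside a set of small
measure. -/
theorem exists_measure_fderiv_lt {Ω : Set E} (hΩ : IsOpen Ω) (hb : Bornology.IsBounded Ω)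
    (hne : Ωᶜ.Nonempty) {p : Seminorm ℝ E} {q : Seminorm ℝ F} {e : F}
    (he : ∀ y, q y ≤ 1 → ‖y‖ ≤ ‖e‖) {u v : E} (h₁ : p (u + v) ≤ 1) (h₂ : p (u - v) ≤ 1)
    {l : E →L[ℝ] ℝ} (hl : l u = 1) {η : ℝ} (hη : 0 < η) {ε : ℝ≥0∞} (hε : 0 < ε) :
    ∃ δ > 0, ∀ (C : ℝ≥0) (G : E → F), LipschitzWith C G →
      (∀ x ∈ Ω, ∀ y ∈ Ω, q (G x - G y) ≤ p (x - y)) → (∀ x ∈ Ω, ‖l x • e - G x‖ ≤ δ) →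
      μ {x ∈ Ω | ¬ (DifferentiableAt ℝ G x ∧ ‖fderiv ℝ G x v‖ < η)} < ε := by
  obtain ⟨δ, hδ, H⟩ := exists_measure_le_lineDeriv_lt μ hΩ hb hne u hε
    (show 0 < η ^ 2 / 2 by positivity)
  refine ⟨δ / (‖e‖ + 1), by positivity, fun C G hG hGΩ hsmall => ?_⟩
  set h : E → ℝ := fun x => ⟪e, l x • e - G x⟫
  have hlip : ∃ C', LipschitzWith C' h :=
    ⟨_, (innerSL ℝ e).lipschitz.comp ((l.smulRight e).lipschitz.sub hG)⟩
  obtain ⟨C', hC'⟩ := hlip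
  have hder : ∀ x, DifferentiableAt ℝ G x →
      lineDeriv ℝ h x u = ‖e‖ ^ 2 - ⟪e, fderiv ℝ G x u⟫ := by
    intro x hx
    have h1 : HasFDerivAt h ((innerSL ℝ e).comp (l.smulRight e - fderiv ℝ G x)) x :=
      (innerSL ℝ e).hasFDerivAt.comp x ((l.smulRight e).hasFDerivAt.sub hx.hasFDerivAt)
    rw [(h1.hasLineDerivAt u).lineDeriv]
    simp [hl]
  have hball : ∀ x ∈ Ω, DifferentiableAt ℝ G x →
      ‖fderiv ℝ G x (u + v)‖ ≤ ‖e‖ ∧ ‖fderiv ℝ G x (u - v)‖ ≤ ‖e‖ := fun x hx hd =>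
    ⟨he _ ((seminorm_fderiv_le_s3 hGΩ (hΩ.mem_nhds hx) hd _).trans h₁),
      he _ ((seminorm_fderiv_le_s3 hGΩ (hΩ.mem_nhds hx) hd _).trans h₂)⟩
  have hae : ∀ᵐ x ∂μ, DifferentiableAt ℝ G x := hG.ae_differentiableAt
  refine lt_of_le_of_lt (measure_mono_ae ?_) (H C' h hC' ?_ fun x hx => ?_)
  · filter_upwards [hae] with x hd hx
    refine ⟨hx.1, ?_⟩
    have h3 : η ≤ ‖fderiv ℝ G x v‖ := not_lt.1 fun h4 => hx.2 ⟨hd, h4⟩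
    have h5 := norm_sq_le_of_norm_le _ (hball x hx.1 hd).1 (hball x hx.1 hd).2
    rw [hder x hd]
    have h6 := pow_le_pow_left₀ hη.le h3 2
    linarith
  · filter_upwards [hae] with x hd hx
    rw [hder x hd]
    exact inner_le_of_norm_le _ (hball x hx hd).1 (hball x hx hd).2
  · calc |h x| ≤ ‖e‖ * ‖l x • e - G x‖ := abs_real_inner_le_norm _ _
      _ ≤ (‖e‖ + 1) * (δ / (‖e‖ + 1)) := by
          gcongr
          · linarith
          · exact hsmall x hx
      _ = δ := by field_simp

end Rigidity

section Main

variable {n m : ℕ}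

theorem extZero_apply {D : Set (Euc n)} (f : ↥D → Euc m) {x : Euc n} (hx : x ∈ D) :
    extZero f x = f ⟨x, hx⟩ :=
  Subtype.val_injective.extend_apply f (fun _ => 0) ⟨x, hx⟩

/-- Near a suitable map of rank one, all elements of `LipAB na nb Ω` have a derivative that almost
kills a fixed vector `v ≠ 0`, outside a set of small measure. -/
theorem exists_ball_fderiv_lt (na : Seminorm ℝ (Euc n)) (nb : Seminorm ℝ (Euc m))
    (hnb : ∀ x, nb x = 0 → x = 0)
    (hu : ∃ u : Euc n, na u = 1 ∧ ¬ IsExtremalPt {x | na x ≤ 1} u)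
    {Ω : Set (Euc n)} (hΩ : IsOpen Ω) (hΩb : Bornology.IsBounded Ω) :
    ∃ (K : ℝ≥0) (v : Euc n), v ≠ 0 ∧ ∃ f₀ : LipAB na nb Ω, ∀ η > 0, ∀ ε > 0, ∃ δ > 0,
      ∀ f ∈ ball f₀ δ, ∃ G : Euc n → Euc m, LipschitzWith K G ∧ EqOn (extZero ⇑f.1) G Ω ∧
        (μH[n] : Measure (Euc n))
          {x ∈ Ω | ¬ (DifferentiableAt ℝ G x ∧ ‖fderiv ℝ G x v‖ < η)} < ε := by
  obtain ⟨u, hu1, hext⟩ := hu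
  obtain ⟨v, h₁, h₂, hv⟩ : ∃ v, na (u + v) ≤ 1 ∧ na (u - v) ≤ 1 ∧ v ≠ 0 := by
    simpa [IsExtremalPt] using hext
  have hne : Ωᶜ.Nonempty := by
    rw [nonempty_compl]
    rintro rfl
    have : Nontrivial (Euc n) := ⟨v, 0, hv⟩
    have : NoncompactSpace (Euc n) := NormedSpace.noncompactSpace ℝ _
    exact noncompact_univ (Euc n) (by simpa using hΩb.isCompact_closure)
  obtain ⟨l, hl, hla⟩ := na.exists_linearMap_eq_one hu1
  obtain ⟨Cb, hCb, hbb⟩ := nb.exists_norm_le_mul hnb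
  obtain ⟨Ca, hCa, hab⟩ := Seminorm.bound_of_continuous_normedSpace na
    na.continuous_of_finiteDimensional
  have hcpt : IsCompact {y | nb y ≤ 1} := by
    refine Metric.isCompact_of_isClosed_isBounded
      (isClosed_le nb.continuous_of_finiteDimensional continuous_const)
      ((isBounded_closedBall (x := (0 : Euc m)) (r := Cb)).subset fun y hy => ?_)
    exact mem_closedBall_zero_iff.2
      ((hbb y).trans (mul_le_of_le_one_right hCb.le hy))
  obtain ⟨e, he, hmax⟩ := hcpt.exists_isMaxOn ⟨0, by simp⟩ continuous_norm.continuousOn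
  have he1 : nb e ≤ 1 := he
  have hf₀c : Continuous fun x : ↥Ω => l x • e := by fun_prop
  obtain ⟨g₀, hg₀⟩ : ∃ g₀ : BoundedContinuousFunction ↥Ω (Euc m), ∀ x, g₀ x = l x • e := by
    obtain ⟨C, hC⟩ := (hΩb.isCompact_closure.image
      (show Continuous fun x => l x • e by fun_prop)).isBounded.exists_norm_le
    exact ⟨BoundedContinuousFunction.ofNormedAddCommGroup _ hf₀c C
      fun x => hC _ (mem_image_of_mem _ (subset_closure x.2)), fun _ => rfl⟩
  refine ⟨lipschitzExtensionConstant (Euc m) * (Cb * Ca).toNNReal, v, hv,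
    ⟨g₀, fun x y => ?_⟩, fun η hη ε hε => ?_⟩
  · rw [hg₀, hg₀, ← sub_smul, ← map_sub, map_smul_eq_mul, Real.norm_eq_abs]
    exact (mul_le_of_le_one_right (abs_nonneg _) he1).trans (hla _)
  obtain ⟨δ, hδ, H⟩ := exists_measure_fderiv_lt (μH[n] : Measure (Euc n)) hΩ hΩb hne
    (p := na) (q := nb) (fun y hy => hmax hy) h₁ h₂ hl hη hε
  refine ⟨δ, hδ, fun f hf => ?_⟩
  have hlip : LipschitzOnWith (Cb * Ca).toNNReal (extZero ⇑f.1) Ω := by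
    refine LipschitzOnWith.of_dist_le_mul fun x hx y hy => ?_
    rw [extZero_apply _ hx, extZero_apply _ hy, dist_eq_norm, dist_eq_norm,
      Real.coe_toNNReal _ (by positivity)]
    calc _ ≤ Cb * nb _ := hbb _
      _ ≤ Cb * (Ca * ‖x - y‖) := by
          gcongr
          exact (f.2 ⟨x, hx⟩ ⟨y, hy⟩).trans (hab _)
      _ = _ := by ring
  obtain ⟨G, hG, hfG⟩ := hlip.extend_finite_dimension
  refine ⟨G, hG, hfG, H _ G hG (fun x hx y hy => ?_) fun x hx => ?_⟩
  · rw [← hfG hx, ← hfG hy, extZero_apply _ hx, extZero_apply _ hy]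
    exact f.2 ⟨x, hx⟩ ⟨y, hy⟩
  · rw [← hfG hx, extZero_apply _ hx, ← hg₀ ⟨x, hx⟩, ← dist_eq_norm, dist_comm]
    exact (BoundedContinuousFunction.dist_coe_le_dist _).trans (le_of_lt hf)

theorem exists_ofReal_mul_add_lt {a b Δ : ℝ≥0∞} (ha : a ≠ ∞) (hb : b ≠ ∞) (hΔ : 0 < Δ) :
    ∃ r : ℝ, 0 < r ∧ ENNReal.ofReal r * a + b * ENNReal.ofReal r < Δ := by
  have h0 := (ENNReal.continuous_ofReal.tendsto 0).mono_left (nhdsWithin_le_nhds (s := Ioi (0 : ℝ)))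
  have hlim := (ENNReal.Tendsto.mul_const h0 (Or.inr ha)).add
    (ENNReal.Tendsto.const_mul h0 (Or.inr hb))
  rw [ENNReal.ofReal_zero, zero_mul, mul_zero, add_zero] at hlim
  obtain ⟨r, h1, h2⟩ := ((hlim.eventually (gt_mem_nhds hΔ)).and self_mem_nhdsWithin).exists
  exact ⟨r, h2, h1⟩

end Main

/-- Let `|·|_a` be a norm on `ℝ^n` whose unit sphere contains a non-extremal
point of its unit ball, `|·|_b` any norm on `ℝ^m` (`n ≤ m`), and `Ω ⊆ ℝ^n` open and bounded.
For every `Δ ≥ 0`, each of the sets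
`{f ∈ Lip_1(Ω_a, ℝ^m_b) : ∫_Ω vol f' dH^n ≥ Δ}` and `{f ∈ Lip_1(Ω_a, ℝ^m_b) : H^n(f(Ω)) ≥ Δ}`
is dense in `Lip_1(Ω_a, ℝ^m_b)` if and only if `Δ = 0`. -/
theorem stmt3 (n m : ℕ) (hnm : n ≤ m)
    (na : Seminorm ℝ (Euc n)) (hna : ∀ x, na x = 0 → x = 0)
    (nb : Seminorm ℝ (Euc m)) (hnb : ∀ x, nb x = 0 → x = 0)
    (hu : ∃ u : Euc n, na u = 1 ∧ ¬ IsExtremalPt {x | na x ≤ 1} u)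
    (Ω : Set (Euc n)) (hΩ : IsOpen Ω) (hΩb : Bornology.IsBounded Ω)
    (Δ : ℝ) (hΔ : 0 ≤ Δ) :
    (Dense {f : LipAB na nb Ω |
        ENNReal.ofReal Δ ≤
          ∫⁻ x in Ω, ENNReal.ofReal (volMap (fderiv ℝ (extZero ⇑f.1) x))
            ∂(μH[n] : Measure (Euc n))} ↔ Δ = 0) ∧
    (Dense {f : LipAB na nb Ω | ENNReal.ofReal Δ ≤ μH[n] (Set.range ⇑f.1)} ↔ Δ = 0) := by
  obtain ⟨K, v, hv, f₀, hf₀⟩ := exists_ball_fderiv_lt na nb hnb hu hΩ hΩb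
  have hfin : (μH[n] : Measure (Euc n)) Ω ≠ ∞ := hΩb.measure_lt_top.ne
  refine ⟨⟨fun hd => ?_, ?_⟩, ⟨fun hd => ?_, ?_⟩⟩
  · by_contra hΔ0
    have hΔpos : 0 < ENNReal.ofReal Δ := ENNReal.ofReal_pos.2 (lt_of_le_of_ne hΔ (Ne.symm hΔ0))
    obtain ⟨M, hM⟩ := exists_volMap_le (n := n) (m := m) K
    obtain ⟨r, hr, hlt⟩ := exists_ofReal_mul_add_lt hfin (ENNReal.ofReal_ne_top (r := M)) hΔpos
    obtain ⟨η, hη, hvol⟩ := exists_volMap_lt (m := m) K hv hr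
    obtain ⟨δ, hδ, H⟩ := hf₀ η hη (ENNReal.ofReal r) (ENNReal.ofReal_pos.2 hr)
    obtain ⟨f, hfδ, hf⟩ := Metric.dense_iff.1 hd f₀ δ hδ
    obtain ⟨G, hG, hfG, hbad⟩ := H f hfδ
    refine (hlt.trans_le (le_trans hf ?_)).false
    set B := {x ∈ Ω | ¬ (DifferentiableAt ℝ G x ∧ ‖fderiv ℝ G x v‖ < η)}
    have hBm : MeasurableSet B :=
      hΩ.measurableSet.inter ((measurableSet_of_differentiableAt ℝ G).inter
        (measurableSet_lt (measurable_fderiv_apply_const ℝ G v).norm measurable_const)).compl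
    have hcongr : ∀ x ∈ Ω, fderiv ℝ (extZero ⇑f.1) x = fderiv ℝ G x := fun x hx =>
      (hfG.eventuallyEq_of_mem (hΩ.mem_nhds hx)).fderiv_eq
    calc _ ≤ ∫⁻ x in Ω, (ENNReal.ofReal r + B.indicator (fun _ => ENNReal.ofReal M) x)
            ∂(μH[n] : Measure (Euc n)) := by
          have hind : Measurable (B.indicator fun _ => ENNReal.ofReal M) :=
            measurable_const.indicator hBm
          refine setLIntegral_mono (hind.const_add _) fun x hx => ?_
          rw [hcongr x hx]
          have hK : ‖fderiv ℝ G x‖ ≤ K := norm_fderiv_le_of_lipschitz ℝ hG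
          by_cases hxB : x ∈ B
          · rw [indicator_of_mem hxB]
            exact le_add_left (ENNReal.ofReal_le_ofReal (hM _ hK))
          · rw [indicator_of_notMem hxB, add_zero]
            have : ‖fderiv ℝ G x v‖ < η := by
              by_contra h
              exact hxB ⟨hx, fun h' => h h'.2⟩
            exact ENNReal.ofReal_le_ofReal (hvol _ hK this).le
      _ ≤ ENNReal.ofReal r * (μH[n] : Measure (Euc n)) Ω
            + ENNReal.ofReal M * ENNReal.ofReal r := by
          rw [lintegral_add_left measurable_const, setLIntegral_const, lintegral_indicator hBm,
            setLIntegral_const]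
          gcongr
          exact (Measure.restrict_apply_le _ _).trans hbad.le
  · rintro rfl
    simp
  · by_contra hΔ0
    have hΔpos : 0 < ENNReal.ofReal Δ := ENNReal.ofReal_pos.2 (lt_of_le_of_ne hΔ (Ne.symm hΔ0))
    obtain ⟨r, hr, hlt⟩ := exists_ofReal_mul_add_lt hfin
      (ENNReal.pow_ne_top ENNReal.coe_ne_top : (K : ℝ≥0∞) ^ n ≠ ∞) hΔpos
    obtain ⟨η, hη, himg⟩ := exists_hausdorffMeasure_image_le (m := m) K hv hr
    obtain ⟨δ, hδ, H⟩ := hf₀ η hη (ENNReal.ofReal r) (ENNReal.ofReal_pos.2 hr)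
    obtain ⟨f, hfδ, hf⟩ := Metric.dense_iff.1 hd f₀ δ hδ
    obtain ⟨G, hG, hfG, hbad⟩ := H f hfδ
    refine (hlt.trans_le (le_trans hf ?_)).false
    set B := {x ∈ Ω | ¬ (DifferentiableAt ℝ G x ∧ ‖fderiv ℝ G x v‖ < η)}
    calc μH[n] (Set.range ⇑f.1) ≤ μH[n] (G '' (Ω \ B) ∪ G '' B) := by
          refine measure_mono ?_
          rintro _ ⟨x, rfl⟩
          rw [← image_union]
          refine ⟨x, by by_cases h : (x : Euc n) ∈ B <;> simp [h], ?_⟩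
          rw [← hfG x.2, extZero_apply _ x.2]
      _ ≤ μH[n] (G '' (Ω \ B)) + μH[n] (G '' B) := measure_union_le _ _
      _ ≤ ENNReal.ofReal r * (μH[n] : Measure (Euc n)) (Ω \ B)
            + (K : ℝ≥0∞) ^ (n : ℝ) * (μH[n] : Measure (Euc n)) B := by
          refine add_le_add (himg G _ hG fun x hx => ?_)
            (hG.hausdorffMeasure_image_le (Nat.cast_nonneg n) B)
          by_contra h
          exact hx.2 ⟨hx.1, h⟩
      _ ≤ ENNReal.ofReal r * (μH[n] : Measure (Euc n)) Ω + (K : ℝ≥0∞) ^ n * ENNReal.ofReal r := by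
          rw [ENNReal.rpow_natCast]
          gcongr
          exact sdiff_subset
  · rintro rfl
    simp
end
end

section
/- Let n be a natural number, let ε > 0, let F : B(0,ε) → B(0,ε) be a continuous self-map of the closed Euclidean ball of radius ε in ℝ^n, and let η ∈ (1/2^n, 1). If |F(y) − y| < ε(1 − η^{1/n}) for all y on the boundary sphere ∂B(0,ε), then F(B(0,ε)) ⊇ B(0, η^{1/n} ε). -/
open MeasureTheory Metric Set Filter Topology ENNReal

noncomputable section

open Module in
/-- The polynomial `t ↦ det (1 + t A)` is recovered at `t = 1` by Lagrange interpolation. -/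
theorem ContinuousLinearMap.det_id_add_eq_sum_lagrange_basis {E : Type*} [NormedAddCommGroup E]
    [NormedSpace ℝ E] [FiniteDimensional ℝ E] (A : E →L[ℝ] E) (s : Finset ℝ)
    (hs : finrank ℝ E < s.card) :
    (ContinuousLinearMap.id ℝ E + A).det =
      ∑ t ∈ s, (ContinuousLinearMap.id ℝ E + t • A).det * (Lagrange.basis s id t).eval 1 := by
  let b := finBasis ℝ E
  let M := LinearMap.toMatrix b b (A : E →ₗ[ℝ] E)
  let P : Polynomial ℝ := Matrix.det
    ((Polynomial.X : Polynomial ℝ) • M.map Polynomial.C + (1 : Matrix _ _ ℝ).map Polynomial.C)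
  have hP : ∀ t : ℝ, (ContinuousLinearMap.id ℝ E + t • A).det = P.eval t := by
    intro t
    have h : P.eval t = (t • M + 1).det := by
      simp only [P, ← Polynomial.coe_evalRingHom, RingHom.map_det]
      congr 1
      ext i j
      by_cases hij : i = j <;> simp [hij] <;> ring
    rw [h, ContinuousLinearMap.det, ← LinearMap.det_toMatrix b]
    congr 1
    simp [M, add_comm]
  have hdeg : P.degree < s.card := by
    refine lt_of_le_of_lt Polynomial.degree_le_natDegree ?_
    have := Polynomial.natDegree_det_X_add_C_le M 1
    rw [Fintype.card_fin] at this
    exact_mod_cast this.trans_lt hs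
  have h := congrArg (Polynomial.eval 1) (Lagrange.eq_interpolate (v := id) (injOn_id _) hdeg)
  have h1 := hP 1
  rw [one_smul] at h1
  rw [h1, h]
  simp [Lagrange.interpolate_apply, Polynomial.eval_finsetSum, hP]

/-- A function that is Lipschitz on a closed ball and vanishes off the open ball is Lipschitz. -/
theorem LipschitzOnWith.lipschitzWith_of_eq_zero_off_ball {E F : Type*} [NormedAddCommGroup E]
    [NormedSpace ℝ E] [NormedAddCommGroup F] {G : E → F} {K : NNReal} {R : ℝ}
    (hG : LipschitzOnWith K G (closedBall 0 R)) (h0 : ∀ x, R ≤ ‖x‖ → G x = 0) :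
    LipschitzWith K G := by
  have key : ∀ x y : E, ‖x‖ ≤ R → R ≤ ‖y‖ → dist (G x) (G y) ≤ K * dist x y := by
    intro x y hx hy
    obtain ⟨z, hz, hzR⟩ := (convex_segment (𝕜 := ℝ) x y).isPreconnected.intermediate_value
      (left_mem_segment ℝ x y) (right_mem_segment ℝ x y) continuous_norm.continuousOn
      (show R ∈ Icc ‖x‖ ‖y‖ from ⟨hx, hy⟩)
    rw [h0 y hy, ← h0 z hzR.ge]
    refine (hG.dist_le_mul x (by simpa using hx) z (by simpa using hzR.le)).trans ?_
    gcongr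
    linarith [dist_add_dist_of_mem_segment hz, dist_nonneg (x := z) (y := y)]
  refine LipschitzWith.of_dist_le_mul fun x y => ?_
  rcases le_total ‖x‖ R with hx | hx <;> rcases le_total ‖y‖ R with hy | hy
  · exact hG.dist_le_mul x (by simpa using hx) y (by simpa using hy)
  · exact key x y hx hy
  · rw [dist_comm, dist_comm x y]
    exact key y x hy hx
  · rw [h0 x hx, h0 y hy, dist_self]
    positivity

/-- If `f` is a `C¹` self-map of a ball fixing the bounding sphere, then the maps
`x ↦ x + t (f x - x)` with `t` small are orientation-preserving bijections of the ball. -/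
theorem exists_pos_forall_bijOn_ball_and_det_pos {E : Type*} [NormedAddCommGroup E]
    [NormedSpace ℝ E] [FiniteDimensional ℝ E] {R : ℝ} {f : E → E} (hf : ContDiff ℝ 1 f)
    (hmap : ∀ x, ‖x‖ ≤ R → ‖f x‖ ≤ R) (hfix : ∀ x, ‖x‖ = R → f x = x) :
    ∃ δ > (0 : ℝ), ∀ t ∈ Ioo 0 δ,
      BijOn (fun x => x + t • (f x - x)) (ball 0 R) (ball 0 R) ∧
      ∀ x ∈ ball (0 : E) R,
        0 < (ContinuousLinearMap.id ℝ E + t • (fderiv ℝ f x - ContinuousLinearMap.id ℝ E)).det := by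
  have hK : IsCompact (closedBall (0 : E) R) := isCompact_closedBall 0 R
  obtain ⟨L, hL⟩ := (hf.sub contDiff_id).contDiffOn.exists_lipschitzOnWith one_ne_zero
    (convex_closedBall (0 : E) R) hK
  let G : E → E := fun x => if ‖x‖ ≤ R then f x - x else 0
  have hGin : ∀ x, ‖x‖ ≤ R → G x = f x - x := fun x hx => if_pos hx
  have hGout : ∀ x, R ≤ ‖x‖ → G x = 0 := by
    intro x hx
    by_cases h : ‖x‖ ≤ R
    · rw [hGin x h, hfix x (le_antisymm h hx), sub_self]
    · exact if_neg h
  have hGL : LipschitzWith L G := by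
    refine LipschitzOnWith.lipschitzWith_of_eq_zero_off_ball (R := R) ?_ hGout
    intro x hx y hy
    rw [hGin x (by simpa using hx), hGin y (by simpa using hy)]
    exact hL hx hy
  obtain ⟨M, hM⟩ := hK.exists_bound_of_continuousOn
    ((hf.continuous_fderiv one_ne_zero).sub
      (continuous_const (y := ContinuousLinearMap.id ℝ E))).continuousOn
  obtain ⟨r, hr, hdet⟩ := Metric.eventually_nhds_iff.1
    ((ContinuousLinearMap.continuous_det (𝕜 := ℝ) (E := E)).continuousAt.eventually
      (lt_mem_nhds (show 0 < (ContinuousLinearMap.id ℝ E).det by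
        simp [ContinuousLinearMap.det])))
  refine ⟨min (min 1 (1 / ((L : ℝ) + 1))) (r / (|M| + 1)), by positivity, fun t ht => ?_⟩
  obtain ⟨ht0, ht1⟩ := ht
  have hδ1 : t < 1 := ht1.trans_le ((min_le_left _ _).trans (min_le_left _ _))
  have hδ2 : t * (L + 1) < 1 := by
    rw [← lt_div_iff₀ (by positivity)]
    exact ht1.trans_le ((min_le_left _ _).trans (min_le_right _ _))
  have hδ3 : t * (|M| + 1) < r := by
    rw [← lt_div_iff₀ (by positivity)]
    exact ht1.trans_le (min_le_right _ _)
  have hcontr : ∀ y : E, ContractingWith (⟨t, ht0.le⟩ * L) (fun x => y - t • G x) := by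
    refine fun y => ⟨?_, LipschitzWith.of_dist_le_mul fun a b => ?_⟩
    · rw [← NNReal.coe_lt_coe]
      push_cast
      change t * L < 1
      nlinarith
    · rw [dist_sub_left, dist_smul₀, Real.norm_of_nonneg ht0.le]
      change _ ≤ t * L * _
      rw [mul_assoc]
      exact mul_le_mul_of_nonneg_left (hGL.dist_le_mul a b) ht0.le
  have hball : ∀ x : E, x ∈ ball (0 : E) R ↔ ‖x‖ < R := fun x => mem_ball_zero_iff
  refine ⟨⟨?_, ?_, ?_⟩, ?_⟩
  · intro x hx
    rw [hball] at hx ⊢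
    have : x + t • (f x - x) = (1 - t) • x + t • f x := by module
    simp only [this]
    calc ‖(1 - t) • x + t • f x‖ ≤ ‖(1 - t) • x‖ + ‖t • f x‖ := norm_add_le _ _
      _ = (1 - t) * ‖x‖ + t * ‖f x‖ := by
        rw [norm_smul, norm_smul, Real.norm_of_nonneg ht0.le, Real.norm_of_nonneg (by linarith)]
      _ < R := by nlinarith [hmap x hx.le]
  · intro x hx y hy hxy
    rw [hball] at hx hy
    have hx' : Function.IsFixedPt (fun z => (x + t • (f x - x)) - t • G z) x := by
      simp [Function.IsFixedPt, hGin x hx.le]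
    have hy' : Function.IsFixedPt (fun z => (x + t • (f x - x)) - t • G z) y := by
      simp only at hxy
      simp [Function.IsFixedPt, hGin y hy.le, hxy]
    exact (hcontr _).fixedPoint_unique' hx' hy'
  · intro y hy
    rw [hball] at hy
    have hx : y - t • G _ = _ := (hcontr y).fixedPoint_isFixedPt
    set x := ContractingWith.fixedPoint _ (hcontr y)
    have hxR : ‖x‖ < R := by
      by_contra! h
      rw [hGout x h, smul_zero, sub_zero] at hx
      rw [← hx] at h
      linarith
    refine ⟨x, (hball x).2 hxR, ?_⟩
    rw [hGin x hxR.le, sub_eq_iff_eq_add] at hx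
    exact hx.symm
  · intro x hx
    apply hdet
    have hMx : ‖fderiv ℝ f x - ContinuousLinearMap.id ℝ E‖ ≤ M :=
      hM x (ball_subset_closedBall hx)
    rw [dist_eq_norm, add_sub_cancel_left, norm_smul, Real.norm_of_nonneg ht0.le]
    refine lt_of_le_of_lt ?_ hδ3
    gcongr
    linarith [le_abs_self M]

/-- There is no `C¹` retraction of a closed ball onto its bounding sphere. -/
theorem exists_norm_ne_of_contDiff_of_fix_sphere {E : Type*} [NormedAddCommGroup E]
    [InnerProductSpace ℝ E] [FiniteDimensional ℝ E] {R : ℝ} (hR : 0 < R) {f : E → E}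
    (hf : ContDiff ℝ 1 f) (hfix : ∀ x, ‖x‖ = R → f x = x) :
    ∃ x, ‖x‖ ≤ R ∧ ‖f x‖ ≠ R := by
  by_contra! hsph
  let _ : MeasurableSpace E := borel E
  have : BorelSpace E := ⟨rfl⟩
  let A : E → E →L[ℝ] E := fun x => fderiv ℝ f x - ContinuousLinearMap.id ℝ E
  have hA : Continuous A := (hf.continuous_fderiv one_ne_zero).sub continuous_const
  let D : ℝ → E → ℝ := fun t x => (ContinuousLinearMap.id ℝ E + t • A x).det
  have hDint : ∀ t, IntegrableOn (D t) (ball 0 R) := by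
    intro t
    have hc : Continuous (D t) :=
      ContinuousLinearMap.continuous_det.comp (continuous_const.add (hA.const_smul t))
    exact (hc.continuousOn.integrableOn_compact (isCompact_closedBall 0 R)).mono_set
      ball_subset_closedBall
  obtain ⟨δ, hδ, hbij⟩ :=
    exists_pos_forall_bijOn_ball_and_det_pos hf (fun x hx => (hsph x hx).le) hfix
  have hvol : ∀ t ∈ Ioo 0 δ, ∫ x in ball 0 R, D t x = volume.real (ball (0 : E) R) := by
    intro t ht
    obtain ⟨hb, hpos⟩ := hbij t ht
    have h := integral_image_eq_integral_abs_det_fderiv_smul (volume : Measure E)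
      (f := fun x => x + t • (f x - x)) (f' := fun x => ContinuousLinearMap.id ℝ E + t • A x)
      measurableSet_ball (fun x _ => ?_) hb.injOn (fun _ => (1 : ℝ))
    · rw [hb.image_eq] at h
      simp only [integral_const, smul_eq_mul, mul_one, measureReal_restrict_apply_univ] at h
      rw [h]
      exact setIntegral_congr_fun measurableSet_ball fun x hx => (abs_of_pos (hpos x hx)).symm
    · have hd : HasFDerivAt f (fderiv ℝ f x) x :=
        (hf.differentiable one_ne_zero x).hasFDerivAt
      exact ((hasFDerivAt_id x).add ((hd.sub (hasFDerivAt_id x)).const_smul t)).hasFDerivWithinAt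
  have hzero : ∀ x ∈ ball (0 : E) R, (ContinuousLinearMap.id ℝ E + A x).det = 0 := by
    intro x hx
    have hAx : ContinuousLinearMap.id ℝ E + A x = fderiv ℝ f x := by simp [A]
    rw [hAx]
    by_contra hne
    have hd : HasFDerivAt f (fderiv ℝ f x) x :=
      (hf.differentiable one_ne_zero x).hasFDerivAt
    have hconst : (fun y => ‖f y‖ ^ 2) =ᶠ[𝓝 x] fun _ => R ^ 2 := by
      filter_upwards [isOpen_ball.mem_nhds hx] with y hy
      rw [hsph y (mem_ball_zero_iff.1 hy).le]
    have hd0 := hd.norm_sq.unique ((hasFDerivAt_const (R ^ 2) x).congr_of_eventuallyEq hconst)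
    have hv := DFunLike.congr_fun hd0
      ((fderiv ℝ f x).toContinuousLinearEquivOfDetNeZero hne |>.symm (f x))
    have hfv : fderiv ℝ f x
        ((fderiv ℝ f x).toContinuousLinearEquivOfDetNeZero hne |>.symm (f x)) = f x :=
      ((fderiv ℝ f x).toContinuousLinearEquivOfDetNeZero hne).apply_symm_apply (f x)
    simp [hfv, hsph x (mem_ball_zero_iff.1 hx).le, hR.ne'] at hv
  obtain ⟨s, hs, hcard⟩ := (Ioo_infinite hδ).exists_subset_card_eq (Module.finrank ℝ E + 1)
  have hbasis : ∑ t ∈ s, (Lagrange.basis s id t).eval 1 = 1 := by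
    rw [← Polynomial.eval_finsetSum, Lagrange.sum_basis (injOn_id _)
      (Finset.card_pos.1 (by omega)), Polynomial.eval_one]
  have hfinal : ∫ x in ball (0 : E) R, (ContinuousLinearMap.id ℝ E + A x).det =
      volume.real (ball (0 : E) R) := by
    simp_rw [fun x => (A x).det_id_add_eq_sum_lagrange_basis s (by omega)]
    rw [integral_finsetSum _ fun t _ => (hDint t).mul_const _]
    simp_rw [integral_mul_const]
    rw [Finset.sum_congr rfl fun t ht => by rw [hvol t (hs ht)], ← Finset.mul_sum, hbasis, mul_one]
  rw [setIntegral_congr_fun measurableSet_ball hzero, integral_zero] at hfinal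
  exact (ENNReal.toReal_pos (measure_ball_pos volume (0 : E) hR).ne'
    measure_ball_lt_top.ne).ne hfinal

/-- A continuous map that is the identity off a ball has a zero. -/
theorem Continuous.exists_eq_zero_of_eq_id_off_ball {E : Type*} [NormedAddCommGroup E]
    [InnerProductSpace ℝ E] [FiniteDimensional ℝ E] {R : ℝ} (hR : 0 < R) {u : E → E}
    (hu : Continuous u) (hid : ∀ x, R ≤ ‖x‖ → u x = x) : ∃ x, u x = 0 := by
  by_contra! hne
  obtain ⟨g, hg, hgapprox, hgsupp⟩ := (hu.sub continuous_id).exists_contDiff_approx 1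
    hu.norm (fun x => norm_pos_iff.2 (hne x))
  have hg0 : ∀ x, R ≤ ‖x‖ → g x = 0 := by
    intro x hx
    by_contra h
    exact hgsupp h (by simp [hid x hx])
  let v : E → E := fun x => x + g x
  have hv : ∀ x, v x ≠ 0 := by
    intro x h
    have := hgapprox x
    have hgx : g x = -x := (neg_eq_of_add_eq_zero_right h).symm
    simp [hgx, dist_comm, dist_eq_norm] at this
  have hvd : ContDiff ℝ 1 v := contDiff_id.add hg
  obtain ⟨x, -, hx⟩ := exists_norm_ne_of_contDiff_of_fix_sphere hR
    (f := fun x => (R / ‖v x‖) • v x)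
    ((contDiff_const.div (hvd.norm ℝ hv) fun x => norm_ne_zero_iff.2 (hv x)).smul hvd)
    (fun x hx => by simp [v, hg0 x hx.ge, hx, hR.ne'])
  refine hx ?_
  rw [norm_smul, Real.norm_of_nonneg (by positivity), div_mul_cancel₀ _ (norm_ne_zero_iff.2 (hv x))]

/-- If a continuous map moves every point of the bounding sphere of a ball of radius `ε` by less
than `ε - ‖p‖`, then it attains the value `p` on the ball. -/
theorem exists_eq_of_norm_sub_lt_on_sphere {E : Type*} [NormedAddCommGroup E]
    [InnerProductSpace ℝ E] [FiniteDimensional ℝ E] {ε : ℝ} (hε : 0 < ε) {F : E → E}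
    (hF : ContinuousOn F (closedBall 0 ε)) {p : E}
    (hbdry : ∀ y, ‖y‖ = ε → ‖F y - y‖ < ε - ‖p‖) : ∃ x ∈ closedBall 0 ε, F x = p := by
  by_contra! hne
  let r : E → E := fun x => (ε / max ε ‖x‖) • x
  let χ : E → ℝ := fun x => max 0 (min 1 (2 - ‖x‖ / ε))
  have hmax : ∀ x : E, 0 < max ε ‖x‖ := fun x => lt_max_of_lt_left hε
  have hr : Continuous r := by
    have : Continuous fun x : E => ε / max ε ‖x‖ :=
      continuous_const.div (by fun_prop) fun x => (hmax x).ne'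
    exact this.smul continuous_id
  have hrmem : ∀ x, r x ∈ closedBall 0 ε := by
    intro x
    rw [mem_closedBall_zero_iff, norm_smul, Real.norm_of_nonneg (by positivity), div_mul_eq_mul_div,
      div_le_iff₀ (hmax x)]
    gcongr
    exact le_max_right _ _
  have hχ : Continuous χ := by fun_prop
  obtain ⟨x, hx⟩ := Continuous.exists_eq_zero_of_eq_id_off_ball (R := 2 * ε) (by positivity)
    (u := fun x => x + χ x • (F (r x) - p - x))
    (continuous_id.add (hχ.smul (((hF.comp_continuous hr hrmem).sub continuous_const).sub
      continuous_id)))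
    (fun x hx => by
      have : χ x = 0 := by
        refine max_eq_left ((min_le_right _ _).trans ?_)
        rw [sub_nonpos, le_div_iff₀ hε]
        exact hx
      simp [this])
  rcases le_total ‖x‖ ε with hxε | hxε
  · have h1 : χ x = 1 := by
      have : ‖x‖ / ε ≤ 1 := (div_le_one hε).2 hxε
      simp only [χ]
      rw [min_eq_left (by linarith), max_eq_right zero_le_one]
    have h2 : r x = x := by simp [r, max_eq_left hxε, hε.ne']
    rw [h1, h2, one_smul, add_sub_cancel, sub_eq_zero] at hx
    exact hne x (by simpa using hxε) hx
  · have hx0 : 0 < ‖x‖ := hε.trans_le hxε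
    set y := r x with hy
    have hyx : x = (‖x‖ / ε) • y := by
      rw [hy]
      simp only [r]
      rw [max_eq_right hxε, smul_smul, div_mul_div_cancel₀ hε.ne', div_self hx0.ne', one_smul]
    have hyn : ‖y‖ = ε := by
      rw [hy]
      simp only [r]
      rw [max_eq_right hxε, norm_smul, Real.norm_of_nonneg (by positivity),
        div_mul_cancel₀ _ hx0.ne']
    have hχ0 : 0 ≤ χ x := le_max_left _ _
    have hχ1 : χ x ≤ 1 := max_le zero_le_one (min_le_left _ _)
    have hin : 0 < inner ℝ (F y - p) y := by
      have e : F y - p = y + ((F y - y) - p) := by abel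
      rw [e, inner_add_left, real_inner_self_eq_norm_sq, hyn]
      have h1 := neg_le_of_abs_le (abs_real_inner_le_norm ((F y - y) - p) y)
      have h2 := norm_sub_le (F y - y) p
      rw [hyn] at h1
      nlinarith [hbdry y hyn]
    have hxy : 0 < inner ℝ x y := by
      rw [hyx, real_inner_smul_left, real_inner_self_eq_norm_sq, hyn]
      positivity
    have hsum : (1 - χ x) * inner ℝ x y + χ x * inner ℝ (F y - p) y = 0 := by
      rw [← real_inner_smul_left, ← real_inner_smul_left, ← inner_add_left]
      have : (1 - χ x) • x + χ x • (F y - p) = x + χ x • (F y - p - x) := by module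
      rw [this, hx, inner_zero_left]
    rcases hχ0.eq_or_lt with h | h
    · rw [← h] at hsum
      linarith
    · nlinarith [mul_pos h hin, mul_nonneg (sub_nonneg.2 hχ1) hxy.le]

/-- Let `F : B(0,ε) → B(0,ε)` be a continuous self-map of the closed Euclidean
ball of radius `ε` in `ℝ^n` and `η ∈ (1/2^n, 1)`. If `|F(y) − y| < ε (1 − η^{1/n})` for all `y`
on the boundary sphere, then `F(B(0,ε)) ⊇ B(0, η^{1/n} ε)`. -/
theorem stmt5 (n : ℕ) (ε : ℝ) (hε : 0 < ε)
    (F : Euc n → Euc n)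
    (hFmaps : MapsTo F (closedBall (0 : Euc n) ε) (closedBall (0 : Euc n) ε))
    (hFcont : ContinuousOn F (closedBall (0 : Euc n) ε))
    (η : ℝ) (hη₁ : 1 / 2 ^ n < η) (hη₂ : η < 1)
    (hbdry : ∀ y ∈ sphere (0 : Euc n) ε, ‖F y - y‖ < ε * (1 - η ^ (1 / (n : ℝ)))) :
    closedBall (0 : Euc n) (η ^ (1 / (n : ℝ)) * ε) ⊆ F '' closedBall (0 : Euc n) ε := by
  intro p hp
  refine exists_eq_of_norm_sub_lt_on_sphere hε hFcont fun y hy => ?_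
  rw [mem_closedBall_zero_iff] at hp
  have := hbdry y (by simpa using hy)
  linarith
end
end

section
/- Let n ≤ m be natural numbers, let Ω ⊂ ℝ^n be open, let f : Ω → ℝ^m be a continuous function, let x ∈ Ω be a point at which the Fréchet derivative f'(x) exists, and let η ∈ (0,1). Then there exist δ > 0 and r₀ > 0 with B(x,r₀) ⊂ Ω such that for every r ≤ r₀ and every continuous function g : B(x,r) → ℝ^m with sup_{y ∈ B(x,r)} |g(y) − f(y)| ≤ δ r, one has H^n(g(B(x,r))) ≥ η · vol f'(x) · H^n(B(x,r)). -/
open MeasureTheory Metric Set Filter Topology ENNReal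

noncomputable section

section DegreeFormula

variable {E : Type*} [NormedAddCommGroup E]

/-- The value at `y` of a polynomial with continuous coefficients, evaluated at `t`. -/
def evalAtPoint (t : ℝ) (y : E) : Polynomial C(E, ℝ) →+* ℝ :=
  Polynomial.eval₂RingHom (ContinuousMap.evalAlgHom ℝ ℝ y).toRingHom t

@[simp] lemma evalAtPoint_X (t : ℝ) (y : E) : evalAtPoint t y Polynomial.X = t := by
  simp [evalAtPoint]

@[simp] lemma evalAtPoint_C (t : ℝ) (y : E) (a : C(E, ℝ)) :
    evalAtPoint t y (Polynomial.C a) = a y := by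
  simp [evalAtPoint]

lemma exists_polynomial_eval_eq_setIntegral [MeasurableSpace E] [BorelSpace E]
    (μ : Measure E) [IsFiniteMeasureOnCompacts μ] {K : Set E} (hK : IsCompact K)
    (P : Polynomial C(E, ℝ)) :
    ∃ q : Polynomial ℝ, ∀ t, q.eval t = ∫ y in K, evalAtPoint t y P ∂μ := by
  refine ⟨∑ i ∈ Finset.range (P.natDegree + 1),
    Polynomial.monomial i (∫ y in K, P.coeff i y ∂μ), fun t => ?_⟩
  have h : ∀ y, evalAtPoint t y P = ∑ i ∈ Finset.range (P.natDegree + 1), P.coeff i y * t ^ i := by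
    intro y
    simp [evalAtPoint, Polynomial.eval₂_eq_sum_range]
  simp_rw [h]
  rw [integral_finsetSum]
  · simp [Polynomial.eval_finsetSum, integral_mul_const]
  · intro i _
    exact ((P.coeff i).continuous.continuousOn.integrableOn_compact hK).mul_const _

variable [InnerProductSpace ℝ E]

lemma exists_polynomial_evalAtPoint_eq_det [FiniteDimensional ℝ E] {v' : E → E →L[ℝ] E}
    (hv' : Continuous v') :
    ∃ P : Polynomial C(E, ℝ), ∀ t y,
      evalAtPoint t y P = (ContinuousLinearMap.id ℝ E + t • v' y).det := by
  classical
  let b := Module.finBasis ℝ E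
  let a (i j) : C(E, ℝ) := ⟨fun y => b.repr (v' y (b j)) i, by
    have h : Continuous fun z : E => b.repr z i :=
      ((b.coord i).continuous_of_finiteDimensional)
    exact h.comp (hv'.clm_apply continuous_const)⟩
  refine ⟨Matrix.det (1 + Matrix.of fun i j => Polynomial.X * Polynomial.C (a i j)),
    fun t y => ?_⟩
  rw [RingHom.map_det, ContinuousLinearMap.det, ← LinearMap.det_toMatrix b]
  congr 1
  ext i j
  by_cases hij : i = j
  · subst hij
    simp [LinearMap.toMatrix_apply, a, mul_comm t]
  · simp [LinearMap.toMatrix_apply, a, hij, mul_comm t]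

lemma exists_polynomial_evalAtPoint_eq_pow {v : E → E} (hv : Continuous v) (p : E) (M : ℝ)
    (k : ℕ) :
    ∃ P : Polynomial C(E, ℝ), ∀ t y,
      evalAtPoint t y P = (1 - ‖y + t • v y - p‖ ^ 2 / M) ^ k := by
  let a : C(E, ℝ) := ⟨fun y => 1 - ‖y - p‖ ^ 2 / M, by fun_prop⟩
  let b : C(E, ℝ) := ⟨fun y => -(2 * inner ℝ (y - p) (v y) / M), by fun_prop⟩
  let c : C(E, ℝ) := ⟨fun y => -(‖v y‖ ^ 2 / M), by fun_prop⟩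
  refine ⟨(Polynomial.C a + Polynomial.C b * Polynomial.X
    + Polynomial.C c * Polynomial.X ^ 2) ^ k, fun t y => ?_⟩
  rw [add_sub_right_comm, norm_add_sq_real]
  simp only [map_pow, map_add, map_mul, evalAtPoint_C, evalAtPoint_X, a, b, c,
    ContinuousMap.coe_mk, real_inner_smul_right, norm_smul, mul_pow, Real.norm_eq_abs, sq_abs]
  ring

lemma exists_pos_forall_det_id_add_pos :
    ∃ ε > (0 : ℝ), ∀ L : E →L[ℝ] E, ‖L‖ < ε → 0 < (ContinuousLinearMap.id ℝ E + L).det := by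
  have hc : Continuous fun L : E →L[ℝ] E => (ContinuousLinearMap.id ℝ E + L).det :=
    ContinuousLinearMap.continuous_det.comp (by fun_prop)
  have h0 : ∀ᶠ L in 𝓝 (0 : E →L[ℝ] E), 0 < (ContinuousLinearMap.id ℝ E + L).det := by
    refine hc.continuousAt.eventually (lt_mem_nhds ?_)
    simp [ContinuousLinearMap.det]
  obtain ⟨ε, hε, h⟩ := Metric.eventually_nhds_iff.1 h0
  exact ⟨ε, hε, fun L hL => h (by simpa using hL)⟩

variable [FiniteDimensional ℝ E]

/-- A small multiple of a Lipschitz field is a bijective perturbation of the identity. -/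
lemma bijective_add_smul {v : E → E} {K : NNReal} (hv : LipschitzWith K v) {t : ℝ}
    (ht0 : 0 ≤ t) (ht : t * K < 1) : Function.Bijective fun y => y + t • v y := by
  lift t to NNReal using ht0
  have hA : ApproximatesLinearOn (fun y => y + t • v y)
      ((ContinuousLinearEquiv.refl ℝ E : E ≃L[ℝ] E) : E →L[ℝ] E) univ (t * K) := by
    intro y _ z _
    have := hv.dist_le_mul y z
    rw [dist_eq_norm, dist_eq_norm] at this
    have e : y + t • v y - (z + t • v z) -
      ((ContinuousLinearEquiv.refl ℝ E : E ≃L[ℝ] E) : E →L[ℝ] E) (y - z) = t • (v y - v z) := by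
      simp [smul_sub]; abel
    rw [e, NNReal.smul_def, norm_smul, NNReal.norm_eq, NNReal.coe_mul, mul_assoc]
    exact mul_le_mul_of_nonneg_left this t.2
  have hs : Subsingleton E ∨ t * K <
      ‖((ContinuousLinearEquiv.refl ℝ E : E ≃L[ℝ] E).symm : E →L[ℝ] E)‖₊⁻¹ := by
    rcases subsingleton_or_nontrivial E with h | h
    · exact Or.inl h
    · right
      have : ‖((ContinuousLinearEquiv.refl ℝ E : E ≃L[ℝ] E).symm : E →L[ℝ] E)‖₊ = 1 := by
        apply NNReal.coe_injective
        simp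
      rw [this, inv_one]
      exact_mod_cast ht
  refine ⟨?_, hA.surjective hs⟩
  have := hA.injOn hs
  exact injOn_univ.1 this

/-- If moreover the field vanishes outside a set, the perturbation preserves that set. -/
lemma image_add_smul_eq {v : E → E} {K : NNReal} (hv : LipschitzWith K v) {S : Set E}
    (hS : ∀ y ∉ S, v y = 0) {t : ℝ} (ht0 : 0 ≤ t) (ht : t * K < 1) :
    (fun y => y + t • v y) '' S = S := by
  have hb := bijective_add_smul hv ht0 ht
  have hc : (fun y => y + t • v y) '' Sᶜ = Sᶜ := by
    conv_rhs => rw [← image_id Sᶜ]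
    exact image_congr fun y hy => by simp [hS y hy]
  rw [image_compl_eq hb] at hc
  exact compl_injective hc

/-- The degree formula for a compactly supported perturbation of the identity, tested on the
powers of `1 - ‖· - p‖² / M`. -/
lemma setIntegral_pow_mul_det_eq [MeasurableSpace E] [BorelSpace E]
    (μ : Measure E) [μ.IsAddHaarMeasure] {v : E → E}
    (hv : ContDiff ℝ 1 v) {S : Set E} (hS : IsCompact S) (hvS : ∀ y ∉ S, v y = 0)
    (p : E) (M : ℝ) (k : ℕ) :
    ∫ y in S, (1 - ‖y + v y - p‖ ^ 2 / M) ^ k *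
        (ContinuousLinearMap.id ℝ E + fderiv ℝ v y).det ∂μ
      = ∫ y in S, (1 - ‖y - p‖ ^ 2 / M) ^ k ∂μ := by
  obtain ⟨P₁, hP₁⟩ := exists_polynomial_evalAtPoint_eq_pow hv.continuous p M k
  obtain ⟨P₂, hP₂⟩ := exists_polynomial_evalAtPoint_eq_det (hv.continuous_fderiv one_ne_zero)
  obtain ⟨q, hq⟩ := exists_polynomial_eval_eq_setIntegral μ hS (P₁ * P₂)
  simp only [map_mul, hP₁, hP₂] at hq
  obtain ⟨K, hK⟩ := ContDiff.lipschitzWith_of_hasCompactSupport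
    (HasCompactSupport.intro hS hvS) hv one_ne_zero
  obtain ⟨ε, hε, hdet⟩ := exists_pos_forall_det_id_add_pos (E := E)
  have hsmall : ∀ t ∈ Ioo 0 (min 1 ε / (K + 1)),
      q.eval t = ∫ y in S, (1 - ‖y - p‖ ^ 2 / M) ^ k ∂μ := by
    rintro t ⟨ht0, ht⟩
    have hK0 : (0 : ℝ) ≤ K := K.2
    rw [lt_div_iff₀ (by positivity), lt_min_iff] at ht
    have ht1 : t * K < 1 := by nlinarith
    have himg := image_add_smul_eq hK hvS ht0.le ht1
    have hder : ∀ y ∈ S, HasFDerivWithinAt (fun y => y + t • v y)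
        (ContinuousLinearMap.id ℝ E + t • fderiv ℝ v y) S y := fun y _ =>
      ((hasFDerivAt_id y).add
        ((hv.differentiable one_ne_zero y).hasFDerivAt.const_smul t)).hasFDerivWithinAt
    have hcv := integral_image_eq_integral_abs_det_fderiv_smul μ hS.measurableSet hder
      (bijective_add_smul hK ht0.le ht1).1.injOn fun z => (1 - ‖z - p‖ ^ 2 / M) ^ k
    rw [himg] at hcv
    rw [hq, hcv]
    refine setIntegral_congr_fun hS.measurableSet fun y _ => ?_
    have hpos := hdet (t • fderiv ℝ v y) (by
      rw [norm_smul, Real.norm_of_nonneg ht0.le]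
      have := norm_fderiv_le_of_lipschitz ℝ hK (x₀ := y)
      nlinarith)
    simp only [abs_of_pos hpos, smul_eq_mul]
    ring
  have hqc : q = Polynomial.C (∫ y in S, (1 - ‖y - p‖ ^ 2 / M) ^ k ∂μ) := by
    refine Polynomial.eq_of_infinite_eval_eq _ _ (Infinite.mono ?_ (Ioo_infinite
      (show (0 : ℝ) < min 1 ε / (K + 1) by positivity)))
    intro t ht
    simpa using hsmall t ht
  have h1 := hq 1
  rw [hqc] at h1
  simpa using h1.symm

lemma exists_add_eq_of_contDiff {v : E → E} (hv : ContDiff ℝ 1 v) {S : Set E}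
    (hS : IsCompact S) (hvS : ∀ y ∉ S, v y = 0) {p : E} (hp : p ∈ interior S) :
    ∃ y ∈ S, y + v y = p := by
  by_contra! hne
  borelize E
  let μ : Measure E := Measure.addHaar
  have hvc := hv.continuous
  have hdc : Continuous fun y => (ContinuousLinearMap.id ℝ E + fderiv ℝ v y).det :=
    ContinuousLinearMap.continuous_det.comp
      (continuous_const.add (hv.continuous_fderiv one_ne_zero))
  have hSne : S.Nonempty := ⟨p, interior_subset hp⟩
  obtain ⟨y₀, hy₀, hmin⟩ := hS.exists_isMinOn hSne
    (f := fun y => ‖y + v y - p‖) (by fun_prop)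
  set ρ := ‖y₀ + v y₀ - p‖ with hρ
  have hρ0 : 0 < ρ := norm_pos_iff.2 (sub_ne_zero.2 (hne y₀ hy₀))
  obtain ⟨M₁, hM₁⟩ := hS.exists_bound_of_continuousOn
    (f := fun y => ‖y + v y - p‖ ^ 2) (by fun_prop)
  obtain ⟨M₂, hM₂⟩ := hS.exists_bound_of_continuousOn
    (f := fun y => ‖y - p‖ ^ 2) (by fun_prop)
  obtain ⟨D, hD⟩ := hS.exists_bound_of_continuousOn hdc.continuousOn
  obtain ⟨s₀, hs₀, hsS⟩ := Metric.isOpen_iff.1 isOpen_interior p hp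
  set M := max M₁ M₂ with hM
  have hM0 : 0 < M := by
    have := hM₁ y₀ hy₀
    rw [Real.norm_of_nonneg (by positivity)] at this
    exact lt_of_lt_of_le (by positivity) (this.trans (le_max_left _ _))
  set s := min s₀ (ρ / 2) with hs
  have hs0 : 0 < s := by positivity
  have hsρ : s < ρ := (min_le_right _ _).trans_lt (by linarith)
  have hball : ball p s ⊆ S :=
    (ball_subset_ball (min_le_left _ _)).trans (hsS.trans interior_subset)
  have hq0 : 0 ≤ 1 - ρ ^ 2 / M := by
    have := hM₁ y₀ hy₀
    rw [Real.norm_of_nonneg (by positivity)] at this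
    rw [sub_nonneg, div_le_one hM0]
    exact this.trans (le_max_left _ _)
  have hqb : 1 - ρ ^ 2 / M < 1 - s ^ 2 / M := by
    have : s ^ 2 / M < ρ ^ 2 / M := by gcongr
    linarith
  have hkey : ∀ k : ℕ, (1 - s ^ 2 / M) ^ k * μ.real (ball p s)
      ≤ D * (1 - ρ ^ 2 / M) ^ k * μ.real S := by
    intro k
    have hint : IntegrableOn (fun y => (1 - ‖y - p‖ ^ 2 / M) ^ k) S μ :=
      ContinuousOn.integrableOn_compact hS (by fun_prop)
    calc (1 - s ^ 2 / M) ^ k * μ.real (ball p s)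
        = ∫ _ in ball p s, (1 - s ^ 2 / M) ^ k ∂μ := by simp [mul_comm]
      _ ≤ ∫ y in ball p s, (1 - ‖y - p‖ ^ 2 / M) ^ k ∂μ := by
          refine setIntegral_mono_on (integrableOn_const (by finiteness)) (hint.mono_set hball)
            measurableSet_ball fun y hy => ?_
          rw [mem_ball, dist_eq_norm] at hy
          have : ‖y - p‖ ^ 2 / M ≤ s ^ 2 / M := by gcongr
          exact pow_le_pow_left₀ (by linarith) (by linarith) k
      _ ≤ ∫ y in S, (1 - ‖y - p‖ ^ 2 / M) ^ k ∂μ := by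
          refine setIntegral_mono_set hint ?_ hball.eventuallyLE
          refine ae_restrict_of_forall_mem hS.measurableSet fun y hy => ?_
          have := hM₂ y hy
          rw [Real.norm_of_nonneg (by positivity)] at this
          have : ‖y - p‖ ^ 2 / M ≤ 1 := (div_le_one hM0).2 (this.trans (le_max_right _ _))
          exact pow_nonneg (by linarith) k
      _ = ∫ y in S, (1 - ‖y + v y - p‖ ^ 2 / M) ^ k *
            (ContinuousLinearMap.id ℝ E + fderiv ℝ v y).det ∂μ :=
          (setIntegral_pow_mul_det_eq μ hv hS hvS p M k).symm
      _ ≤ ‖∫ y in S, (1 - ‖y + v y - p‖ ^ 2 / M) ^ k *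
            (ContinuousLinearMap.id ℝ E + fderiv ℝ v y).det ∂μ‖ := le_abs_self _
      _ ≤ D * (1 - ρ ^ 2 / M) ^ k * μ.real S := by
          refine norm_setIntegral_le_of_norm_le_const hS.measure_lt_top fun y hy => ?_
          have h1 := hM₁ y hy
          rw [Real.norm_of_nonneg (by positivity)] at h1
          have h1' : ‖y + v y - p‖ ^ 2 / M ≤ 1 :=
            (div_le_one hM0).2 (h1.trans (le_max_left _ _))
          have h2 : ρ ^ 2 / M ≤ ‖y + v y - p‖ ^ 2 / M := by
            have : ρ ≤ ‖y + v y - p‖ := hmin hy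
            gcongr
          rw [norm_mul, norm_pow, Real.norm_of_nonneg (sub_nonneg.2 h1'), mul_comm]
          have hDy := hD y hy
          exact mul_le_mul hDy (pow_le_pow_left₀ (by linarith) (by linarith) k)
            (pow_nonneg (by linarith) k) ((norm_nonneg _).trans hDy)
  have hb0 : 0 < 1 - s ^ 2 / M := hq0.trans_lt hqb
  have hm : 0 < μ.real (ball p s) :=
    ENNReal.toReal_pos (measure_ball_pos μ p hs0).ne' measure_ball_lt_top.ne
  have hlim : Tendsto (fun k : ℕ => D * μ.real S *
      ((1 - ρ ^ 2 / M) / (1 - s ^ 2 / M)) ^ k) atTop (𝓝 (D * μ.real S * 0)) :=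
    (tendsto_pow_atTop_nhds_zero_of_lt_one (div_nonneg hq0 hb0.le)
      ((div_lt_one hb0).2 hqb)).const_mul _
  rw [mul_zero] at hlim
  refine hm.not_ge (ge_of_tendsto' hlim fun k => ?_)
  rw [div_pow, mul_div_assoc', le_div_iff₀ (by positivity)]
  linarith [hkey k]

/-- A continuous map that moves no point of a closed ball by more than `ε` covers the concentric
ball whose radius is smaller by `ε`. -/
lemma ball_subset_image_closedBall {h : E → E} {c : E} {r ε : ℝ} (hr : 0 ≤ r)
    (hc : ContinuousOn h (closedBall c r)) (hε : ∀ y ∈ closedBall c r, ‖h y - y‖ ≤ ε) :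
    ball c (r - ε) ⊆ h '' closedBall c r := by
  have hK : IsCompact (closedBall c r) := isCompact_closedBall c r
  intro p hp
  rw [← (hK.image_of_continuousOn hc).isClosed.closure_eq, Metric.mem_closure_iff]
  intro β hβ
  rw [mem_ball, dist_eq_norm] at hp
  set γ := min β ((r - ε - ‖p - c‖) / 2) with hγ
  have hγ0 : 0 < γ := lt_min hβ (by linarith)
  have hγβ : γ ≤ β := min_le_left _ _
  have hγ2 : γ ≤ (r - ε - ‖p - c‖) / 2 := min_le_right _ _
  let χ : E → ℝ := fun y => min 1 ((r - ‖y - c‖) / γ)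
  let w : E → E := indicator (closedBall c r) fun y => χ y • (h y - y)
  have hw : Continuous w := by
    refine continuous_indicator (fun y hy => ?_) ?_
    · have : ‖y - c‖ = r := by
        simpa [dist_eq_norm] using frontier_closedBall_subset_sphere hy
      simp [χ, this]
    · rw [isClosed_closedBall.closure_eq]
      refine ContinuousOn.smul ?_ (hc.sub continuousOn_id)
      exact Continuous.continuousOn (by fun_prop)
  obtain ⟨v, hv, hvw, hsupp⟩ := hw.exists_contDiff_approx 1 (ε := fun _ => γ)
    continuous_const fun _ => hγ0
  have hvS : ∀ y ∉ closedBall c r, v y = 0 := by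
    intro y hy
    by_contra hne
    exact hsupp hne (indicator_of_notMem hy _)
  have hε0 : 0 ≤ ε := (norm_nonneg _).trans (hε c (mem_closedBall_self hr))
  obtain ⟨y, hy, hyp⟩ := exists_add_eq_of_contDiff (by exact_mod_cast hv) hK hvS
    (ball_subset_interior_closedBall (mem_ball.2 (by rw [dist_eq_norm]; linarith)) :
      p ∈ interior (closedBall c r))
  have hwy : w y = χ y • (h y - y) := indicator_of_mem hy _
  have hyr : ‖y - c‖ ≤ r := by simpa [dist_eq_norm] using hy
  have hχ0 : 0 ≤ χ y := le_min zero_le_one (div_nonneg (by linarith) hγ0.le)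
  have hwε : ‖w y‖ ≤ ε := by
    rw [hwy, norm_smul, Real.norm_of_nonneg hχ0]
    calc χ y * ‖h y - y‖ ≤ 1 * ε :=
          mul_le_mul (min_le_left _ _) (hε y hy) (norm_nonneg _) zero_le_one
      _ = ε := one_mul ε
  have hvwy := hvw y
  rw [dist_eq_norm] at hvwy
  have hyc : ‖y - c‖ ≤ r - γ := by
    have e : y - c = (p - c) - (v y - w y) - w y := by rw [← hyp]; abel
    have h1 := norm_sub_le ((p - c) - (v y - w y)) (w y)
    have h2 := norm_sub_le (p - c) (v y - w y)
    rw [← e] at h1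
    linarith
  have hχ : χ y = 1 := min_eq_left ((one_le_div hγ0).2 (by linarith))
  refine ⟨h y, mem_image_of_mem h hy, ?_⟩
  rw [dist_eq_norm, ← hyp]
  have e : y + v y - h y = v y - w y := by rw [hwy, hχ, one_smul]; abel
  rw [e]
  exact hvwy.trans_le hγβ

end DegreeFormula

lemma volMap_eq_normDet {n m : ℕ} (A : Euc n →L[ℝ] Euc m) :
    volMap A = (A : Euc n →ₗ[ℝ] Euc m).normDet := by
  have h := (A : Euc n →ₗ[ℝ] Euc m).normDet_sq_eq_det_gram (EuclideanSpace.basisFun (Fin n) ℝ)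
  have hM : Matrix.transpose (matrixOf A) * matrixOf A = Matrix.gram ℝ
      (fun j => (A : Euc n →ₗ[ℝ] Euc m) (EuclideanSpace.basisFun (Fin n) ℝ j)) := by
    ext i j
    simp [Matrix.mul_apply, matrixOf, PiLp.inner_apply, mul_comm]
  rw [volMap, hM, ← h]
  exact Real.sqrt_sq (LinearMap.normDet_nonneg _)

/-- An injective linear map has a left inverse `L` such that `A ∘ L` is an orthogonal projection. -/
lemma exists_leftInverse_lipschitzWith_comp {U V : Type*} [NormedAddCommGroup U]
    [InnerProductSpace ℝ U] [FiniteDimensional ℝ U] [NormedAddCommGroup V]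
    [InnerProductSpace ℝ V] [FiniteDimensional ℝ V] (A : U →L[ℝ] V)
    (hA : Function.Injective A) :
    ∃ L : V →L[ℝ] U, (∀ u, L (A u) = u) ∧ LipschitzWith 1 fun z => A (L z) := by
  let R := (A : U →ₗ[ℝ] V).range
  let e : U ≃ₗ[ℝ] R := LinearEquiv.ofInjective (A : U →ₗ[ℝ] V) hA
  refine ⟨(e.symm : R →ₗ[ℝ] U).toContinuousLinearMap ∘L R.orthogonalProjectionOnto, fun u => ?_, ?_⟩
  · have h : R.orthogonalProjectionOnto (A u) = e u :=
      R.orthogonalProjectionOnto_mem_subspace_eq_self (e u)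
    simp [h]
  · have h : ∀ z, A (e.symm (R.orthogonalProjectionOnto z)) = R.starProjection z := fun z =>
      congrArg Subtype.val (e.apply_symm_apply (R.orthogonalProjectionOnto z))
    simp only [ContinuousLinearMap.comp_apply, LinearMap.coe_toContinuousLinearMap',
      LinearEquiv.coe_coe, h]
    refine R.starProjection.lipschitz.weaken ?_
    exact_mod_cast R.starProjection_norm_le

/-- **local lower semicontinuity of area.** Let `Ω ⊆ ℝ^n` be open,
`f : Ω → ℝ^m` continuous, differentiable at `x ∈ Ω` with derivative `A`, and `η ∈ (0,1)`.
Then there are `δ > 0` and `r₀ > 0` with `B(x,r₀) ⊆ Ω` such that for all `0 < r ≤ r₀` and all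
continuous `g : B(x,r) → ℝ^m` with `‖g − f‖_∞ ≤ δ r` one has
`H^n(g(B(x,r))) ≥ η · vol A · H^n(B(x,r))`. -/
theorem stmt6 (n m : ℕ) (hnm : n ≤ m)
    (Ω : Set (Euc n)) (hΩ : IsOpen Ω)
    (f : Euc n → Euc m) (hf : ContinuousOn f Ω)
    (x : Euc n) (hx : x ∈ Ω)
    (A : Euc n →L[ℝ] Euc m) (hA : HasFDerivAt f A x)
    (η : ℝ) (hη₁ : 0 < η) (hη₂ : η < 1) :
    ∃ δ > (0 : ℝ), ∃ r₀ > (0 : ℝ), closedBall x r₀ ⊆ Ω ∧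
      ∀ r : ℝ, 0 < r → r ≤ r₀ →
        ∀ g : Euc n → Euc m, ContinuousOn g (closedBall x r) →
          (∀ y ∈ closedBall x r, ‖g y - f y‖ ≤ δ * r) →
          ENNReal.ofReal (η * volMap A) * μH[n] (closedBall x r)
            ≤ μH[n] (g '' closedBall x r) := by
  have hvol := volMap_eq_normDet A
  by_cases h0 : volMap A = 0
  · obtain ⟨r₀, hr₀, hsub⟩ := Metric.nhds_basis_closedBall.mem_iff.1 (hΩ.mem_nhds hx)
    exact ⟨1, one_pos, r₀, hr₀, hsub, fun r _ _ g _ _ => by simp [h0]⟩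
  have hinj : Function.Injective A := by
    rw [hvol] at h0
    exact LinearMap.ker_eq_bot.1
      (not_not.1 (mt LinearMap.normDet_eq_zero_iff_ker_ne_bot.2 h0))
  obtain ⟨L, hLA, hLip⟩ := exists_leftInverse_lipschitzWith_comp A hinj
  set ε := (1 - η) / (n + 1) with hε
  have hε0 : 0 < ε := div_pos (by linarith) (by positivity)
  have hεn : ε * (n + 1) = 1 - η := div_mul_cancel₀ _ (by positivity)
  have hε1 : ε < 1 := by
    have : 0 ≤ ε * n := by positivity
    linarith
  have hpow : η ≤ (1 - ε) ^ n := by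
    have := one_add_mul_le_pow (a := -ε) (by linarith) n
    rw [← sub_eq_add_neg] at this
    linarith
  set δ := ε / (2 * (‖L‖ + 1)) with hδ
  have hδ0 : 0 < δ := by positivity
  have hLδ : ‖L‖ * (2 * δ) ≤ ε := by
    have : (‖L‖ + 1) * (2 * δ) = ε := by rw [hδ]; field_simp
    linarith
  have hev : ∀ᶠ y in 𝓝 x, y ∈ Ω ∧ ‖f y - f x - A (y - x)‖ ≤ δ * ‖y - x‖ :=
    (hΩ.eventually_mem hx).and (hA.isLittleO.def hδ0)
  obtain ⟨r₀, hr₀, hsub⟩ := Metric.nhds_basis_closedBall.mem_iff.1 hev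
  refine ⟨δ, hδ0, r₀, hr₀, fun y hy => (hsub hy).1, fun r hr hrr₀ g hg hgf => ?_⟩
  have hcover : ball x (r - ε * r) ⊆ (fun y => L (g y) + (x - L (f x))) '' closedBall x r := by
    refine ball_subset_image_closedBall hr.le
      ((L.continuous.comp_continuousOn hg).add continuousOn_const) fun y hy => ?_
    have e : L (g y) + (x - L (f x)) - y = L ((g y - f y) + (f y - f x - A (y - x))) := by
      simp only [map_add, map_sub, hLA]
      abel
    have hyr : ‖y - x‖ ≤ r := by simpa [dist_eq_norm] using hy
    have h1 := (hsub (closedBall_subset_closedBall hrr₀ hy)).2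
    have h2 : ‖(g y - f y) + (f y - f x - A (y - x))‖ ≤ 2 * δ * r := by
      have := mul_le_mul_of_nonneg_left hyr hδ0.le
      linarith [norm_add_le (g y - f y) (f y - f x - A (y - x)), hgf y hy]
    rw [e]
    calc _ ≤ ‖L‖ * (2 * δ * r) := L.le_opNorm_of_le h2
      _ = ‖L‖ * (2 * δ) * r := by ring
      _ ≤ ε * r := by gcongr
  have hLg : (μH[n] : Measure (Euc n)) (ball x (r - ε * r))
      ≤ μH[n] (L '' (g '' closedBall x r)) := by
    rw [← (IsometryEquiv.addRight (x - L (f x))).hausdorffMeasure_image n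
      (L '' (g '' closedBall x r)), image_image, image_image]
    exact measure_mono hcover
  have hAL : ENNReal.ofReal (volMap A) * μH[n] (L '' (g '' closedBall x r))
      ≤ μH[n] (g '' closedBall x r) := by
    have h1 := (A : Euc n →ₗ[ℝ] Euc m).hausdorffMeasure_image (L '' (g '' closedBall x r))
    rw [finrank_euclideanSpace_fin] at h1
    rw [hvol, ← h1, image_image]
    simpa using hLip.hausdorffMeasure_image_le (d := n) n.cast_nonneg (g '' closedBall x r)
  have : (μH[n] : Measure (Euc n)).IsAddHaarMeasure := by
    simpa using isAddHaarMeasure_hausdorffMeasure (E := Euc n)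
  have hball : ENNReal.ofReal η * (μH[n] : Measure (Euc n)) (closedBall x r)
      ≤ μH[n] (ball x (r - ε * r)) := by
    have hr' : 0 < r - ε * r := by nlinarith
    rw [Measure.addHaar_closedBall _ _ hr.le, Measure.addHaar_ball_of_pos _ _ hr', ← mul_assoc,
      ← ENNReal.ofReal_mul hη₁.le, finrank_euclideanSpace_fin]
    gcongr
    calc η * r ^ n ≤ (1 - ε) ^ n * r ^ n := by gcongr
      _ = (r - ε * r) ^ n := by rw [← mul_pow]; ring
  calc ENNReal.ofReal (η * volMap A) * μH[n] (closedBall x r)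
      = ENNReal.ofReal (volMap A) * (ENNReal.ofReal η * μH[n] (closedBall x r)) := by
        rw [mul_comm η, ENNReal.ofReal_mul (hvol ▸ LinearMap.normDet_nonneg _), mul_assoc]
    _ ≤ ENNReal.ofReal (volMap A) * μH[n] (L '' (g '' closedBall x r)) := by
        gcongr
        exact hball.trans hLg
    _ ≤ μH[n] (g '' closedBall x r) := hAL
end
end
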